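/- Let d be a two-dimensional configuration over a finite alphabet and u ∈ ℤ² nonzero such that d admits a u-balanced set D ⊆ ℤ². Assume there is a configuration e in the orbit closure of d and a stripe S = S_u^k = { x ∈ ℤ² : −k < ⟨x,u⟩ ≤ 0 } such that D fits in S (i.e., D + t ⊆ S for some t ∈ ℤ²), d and e agree on the interior S° = { x ∈ ℤ² : −k < ⟨x,u⟩ < 0 }, but d and e differ on S. Then d is periodic with a periodicity vector perpendicular to u, i.e., τ^p(d) = d for some nonzero p ∈ ℤ² with ⟨p, u⟩ = 0. -/

import Mathlib

/-- Translation of a configuration by `t`: `(Translate t c) n = c (n - t)`. -/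
def Translate {A : Type*} (t : ℤ × ℤ) (c : ℤ × ℤ → A) : ℤ × ℤ → A :=
  fun n => c (n - t)

/-- The orbit of a configuration: the set of all its translates. -/
def orbit {A : Type*} (c : ℤ × ℤ → A) : Set (ℤ × ℤ → A) :=
  { d | ∃ t : ℤ × ℤ, d = Translate t c }

/-- The orbit closure: the topological closure of the orbit (in the product
topology of the discrete topology on the alphabet). -/
def orbitClosure {A : Type*} [TopologicalSpace A] (c : ℤ × ℤ → A) : Set (ℤ × ℤ → A) :=
  closure (orbit c)

/-- The standard inner product on `ℤ²`. -/
def inner2 (x u : ℤ × ℤ) : ℤ := x.1 * u.1 + x.2 * u.2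

/-- The discrete half plane in direction `u`. -/
def halfPlane (u : ℤ × ℤ) : Set (ℤ × ℤ) := { x | inner2 x u < 0 }

/-- A set of configurations is deterministic in direction `u`: the contents of a
configuration on the half plane `H_u` determine the whole configuration. -/
def DeterministicIn {A : Type*} (X : Set (ℤ × ℤ → A)) (u : ℤ × ℤ) : Prop :=
  ∀ d ∈ X, ∀ e ∈ X, Set.EqOn d e (halfPlane u) → d = e

/-- The set of `D`-patterns appearing in `c` : restrictions of translates of `c` to `D`. -/
def patterns {A : Type*} (c : ℤ × ℤ → A) (D : Set (ℤ × ℤ)) : Set (D → A) :=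
  { p | ∃ t : ℤ × ℤ, ∀ x : D, p x = Translate t c x }

/-- A configuration is periodic if it is fixed by some non-trivial translation. -/
def Periodic {A : Type*} (c : ℤ × ℤ → A) : Prop :=
  ∃ t : ℤ × ℤ, t ≠ 0 ∧ Translate t c = c

/-- The discrete rectangle `{1,…,n} × {1,…,m}`. -/
def rect (n m : ℕ) : Set (ℤ × ℤ) :=
  { x | 1 ≤ x.1 ∧ x.1 ≤ (n : ℤ) ∧ 1 ≤ x.2 ∧ x.2 ≤ (m : ℤ) }

/-- The edge of `D` in direction `u`: the cells of `D` furthest in direction `u`. -/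
def edge (u : ℤ × ℤ) (D : Set (ℤ × ℤ)) : Set (ℤ × ℤ) :=
  { v ∈ D | ∀ x ∈ D, inner2 x u ≤ inner2 v u }

/-- A set `D ⊆ ℤ²` is (discretely) convex if it is the set of lattice points of a
convex subset of the real plane. -/
def DiscreteConvex (D : Set (ℤ × ℤ)) : Prop :=
  ∃ C : Set (ℝ × ℝ), Convex ℝ C ∧
    D = (fun x : ℤ × ℤ => ((x.1 : ℝ), (x.2 : ℝ))) ⁻¹' C

/-- `D` is `u`-balanced in `c`: `D` is finite, non-empty and convex, `c` has low
complexity with respect to `D`, fewer than `|E|` many `(D ∖ E)`-patterns of `c`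
extend ambiguously to `D`-patterns (condition (ii)), and every lattice line
perpendicular to `u` meeting `D` meets it in at least `|E| − 1` cells, where
`E = E_u(D)` is the edge of `D` in direction `u`. -/
def IsBalanced {A : Type*} (c : ℤ × ℤ → A) (u : ℤ × ℤ) (D : Set (ℤ × ℤ)) : Prop :=
  D.Finite ∧ D.Nonempty ∧ DiscreteConvex D ∧
    (patterns c D).ncard ≤ D.ncard ∧
    (patterns c (D \ edge u D)).ncard < (patterns c D).ncard + (edge u D).ncard ∧
    ∀ a : ℤ, { x ∈ D | inner2 x u = a }.Nonempty →
      (edge u D).ncard - 1 ≤ { x ∈ D | inner2 x u = a }.ncard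

/-- The closed stripe of width `k` perpendicular to `u`. -/
def stripe (u : ℤ × ℤ) (k : ℤ) : Set (ℤ × ℤ) :=
  { x | -k < inner2 x u ∧ inner2 x u ≤ 0 }

/-- The interior of the stripe. -/
def stripeInterior (u : ℤ × ℤ) (k : ℤ) : Set (ℤ × ℤ) :=
  { x | -k < inner2 x u ∧ inner2 x u < 0 }

/-- The correlation `x ↦ ∑ k, c k * s (x + k)` of a finitely supported sequence with a sequence. -/
noncomputable def corr (c : ℤ →₀ ℚ) (s : ℤ → ℚ) (x : ℤ) : ℚ :=
  c.sum fun k r => r * s (x + k)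

/-- The convolution `x ↦ ∑ k, c k * s (x - k)`, the adjoint of `corr`. -/
noncomputable def corrAdj (c : ℤ →₀ ℚ) (s : ℤ → ℚ) (x : ℤ) : ℚ :=
  c.sum fun k r => r * s (x - k)

theorem corr_sub (c : ℤ →₀ ℚ) (s s' : ℤ → ℚ) (x : ℤ) :
    corr c (fun x => s x - s' x) x = corr c s x - corr c s' x := by
  simp [corr, Finsupp.sum, mul_sub, Finset.sum_sub_distrib]

theorem corr_shift (c : ℤ →₀ ℚ) (s : ℤ → ℚ) (q x : ℤ) :
    corr c (fun x => s (x + q)) x = corr c s (x + q) := by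
  simp only [corr, Finsupp.sum]
  refine Finset.sum_congr rfl fun k _ => ?_
  congr 2; ring

theorem corr_periodic {c : ℤ →₀ ℚ} {s : ℤ → ℚ} {q : ℤ} (h : ∀ x, s (x + q) = s x) (x : ℤ) :
    corr c s (x + q) = corr c s x := by
  rw [← corr_shift]; simp [h]

/-- If all but one of the values entering a vanishing correlation vanish, so does the last. -/
theorem eq_zero_of_corr_eq_zero {c : ℤ →₀ ℚ} {s : ℤ → ℚ} {x k : ℤ} (hk : c k ≠ 0)
    (h : corr c s x = 0) (hz : ∀ k', c k' ≠ 0 → k' ≠ k → s (x + k') = 0) : s (x + k) = 0 := by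
  rw [corr, Finsupp.sum, Finset.sum_eq_single k] at h
  · simpa [hk] using h
  · intro k' hk' hne
    rw [hz k' (by simpa using hk') hne, mul_zero]
  · intro hk'
    simp at hk'
    simp [hk']

/-- Sequences with values in a finite set annihilated by a fixed nonzero correlation have
bounded periods. -/
theorem exists_period_of_corr_eq_zero (V : Finset ℚ) {c : ℤ →₀ ℚ} (hc : c ≠ 0) :
    ∃ N : ℕ, ∀ s : ℤ → ℚ, (∀ x, s x ∈ V) → (∀ x, corr c s x = 0) →
      ∃ m : ℕ, 0 < m ∧ m ≤ N ∧ ∀ x, s (x + m) = s x := by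
  have hne : c.support.Nonempty := Finsupp.support_nonempty_iff.2 hc
  obtain ⟨lo, hlo, hlo'⟩ : ∃ lo, c lo ≠ 0 ∧ ∀ k, c k ≠ 0 → lo ≤ k :=
    ⟨c.support.min' hne, by simpa using c.support.min'_mem hne,
      fun k hk => c.support.min'_le k (by simpa using hk)⟩
  obtain ⟨hi, hhi, hhi'⟩ : ∃ hi, c hi ≠ 0 ∧ ∀ k, c k ≠ 0 → k ≤ hi :=
    ⟨c.support.max' hne, by simpa using c.support.max'_mem hne,
      fun k hk => c.support.le_max' k (by simpa using hk)⟩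
  have hlh := hlo' hi hhi
  obtain ⟨w, hw⟩ : ∃ w : ℕ, hi = lo + w := ⟨(hi - lo).toNat, by omega⟩
  refine ⟨Fintype.card (Fin w → V), fun s hs h0 => ?_⟩
  obtain ⟨i, j, hij, hst⟩ := Fintype.exists_ne_map_eq_of_card_lt
    (fun (i : Fin (Fintype.card (Fin w → V) + 1)) (k : Fin w) =>
      (⟨s ((i : ℕ) + (k : ℕ)), hs _⟩ : V)) (by simp)
  wlog hlt : i < j generalizing i j
  · exact this j i hij.symm hst.symm (lt_of_le_of_ne (not_lt.1 hlt) hij.symm)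
  have hlt' : (i : ℕ) < (j : ℕ) := hlt
  obtain ⟨m, hm⟩ : ∃ m : ℕ, (j : ℕ) = i + m := ⟨j - i, by omega⟩
  refine ⟨m, by omega, by omega, ?_⟩
  have hdiff : ∀ x, corr c (fun x => s (x + m) - s x) x = 0 := fun x => by
    rw [corr_sub, corr_shift, h0, h0, sub_self]
  let Pr : ℤ → Prop := fun x => ∀ k : ℤ, 0 ≤ k → k < w → s (x + k + m) - s (x + k) = 0
  have hup : ∀ x, Pr x → s (x + w + m) - s (x + w) = 0 := by
    intro x hx
    have := eq_zero_of_corr_eq_zero hhi (hdiff (x - lo)) (fun k' hk' hne => by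
      have h1 := hlo' k' hk'
      have h2 := hhi' k' hk'
      have := hx (k' - lo) (by omega) (by omega)
      rw [show x - lo + k' = x + (k' - lo) by ring]; exact this)
    rw [show x - lo + hi = x + w by omega] at this
    exact this
  have hbase : Pr i := by
    intro k hk0 hkw
    have := congrFun hst ⟨k.toNat, by omega⟩
    simp only [Subtype.mk.injEq] at this
    rw [hm] at this
    push_cast at this
    rw [Int.toNat_of_nonneg hk0] at this
    rw [this, show (i : ℤ) + k + m = i + m + k by ring, sub_self]
  have hall : ∀ x, Pr x := by
    intro x
    obtain ⟨z, rfl⟩ : ∃ z : ℤ, x = i + z := ⟨x - i, by ring⟩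
    induction z using Int.induction_on with
    | zero => simpa using hbase
    | succ z ih =>
      intro k hk0 hkw
      by_cases h : k + 1 < w
      · have := ih (k + 1) (by omega) h
        rw [show (i : ℤ) + (z + 1) + k = i + z + (k + 1) by ring]; exact this
      · rw [show (i : ℤ) + (z + 1) + k = i + z + w by omega]; exact hup _ ih
    | pred z ih =>
      intro k hk0 hkw
      by_cases h : 0 < k
      · have := ih (k - 1) (by omega) (by omega)
        rw [show (i : ℤ) + (-z - 1) + k = i + -z + (k - 1) by ring]; exact this
      · have hk : k = 0 := by omega
        have := eq_zero_of_corr_eq_zero hlo (hdiff (i + -z - 1 - lo)) (fun k' hk' hne => by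
          have h1 := hlo' k' hk'
          have h2 := hhi' k' hk'
          have := ih (k' - lo - 1) (by omega) (by omega)
          rw [show (i : ℤ) + -z - 1 - lo + k' = i + -z + (k' - lo - 1) by ring]; exact this)
        rw [show (i : ℤ) + (-z - 1) + k = i + -z - 1 - lo + lo by rw [hk]; ring]
        exact this
  intro x
  have := hup (x - w) (hall _)
  rw [show x - w + w = x by ring] at this
  linarith

theorem periodic_nsmul {B : Type*} {s : ℤ → B} {q : ℤ} (h : ∀ x, s (x + q) = s x) (k : ℤ) (x : ℤ) :
    s (x + k * q) = s x := by
  have : Function.Periodic s q := h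
  simpa using this.int_mul k x

theorem periodic_of_dvd {B : Type*} {s : ℤ → B} {q q' : ℤ} (h : ∀ x, s (x + q) = s x) (hd : q ∣ q')
    (x : ℤ) : s (x + q') = s x := by
  obtain ⟨k, rfl⟩ := hd
  rw [mul_comm]; exact periodic_nsmul h k x

/-- A sequence with values in a finite set which has a periodic correlation with a nonzero
finitely supported sequence is itself periodic, with the same period if that is divisible enough. -/
theorem exists_periodic_of_corr_periodic (V : Finset ℚ) {c : ℤ →₀ ℚ} (hc : c ≠ 0) :
    ∃ m₀ : ℕ, 0 < m₀ ∧ ∀ s : ℤ → ℚ, (∀ x, s x ∈ V) → ∀ q : ℕ, m₀ ∣ q →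
      (∀ x, corr c s (x + q) = corr c s x) → ∀ x, s (x + q) = s x := by
  classical
  obtain ⟨N, hN⟩ := exists_period_of_corr_eq_zero (Finset.image₂ (fun a b => a - b) V V) hc
  refine ⟨N.factorial, N.factorial_pos, fun s hs q hd hper => ?_⟩
  obtain ⟨m, hm0, hmN, hm⟩ := hN (fun x => s (x + q) - s x)
    (fun x => Finset.mem_image₂.2 ⟨_, hs _, _, hs _, rfl⟩)
    (fun x => by rw [corr_sub, corr_shift, hper, sub_self])
  have hη : ∀ x, s (x + q + q) - s (x + q) = s (x + q) - s x := fun x =>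
    periodic_of_dvd (s := fun x => s (x + q) - s x) hm
      (Int.natCast_dvd_natCast.2 ((Nat.dvd_factorial hm0 hmN).trans hd)) x
  intro x
  by_contra hne
  have hlin : ∀ k : ℕ, s (x + k * q) = s x + k * (s (x + q) - s x) ∧
      s (x + k * q + q) - s (x + k * q) = s (x + q) - s x := by
    intro k
    induction k with
    | zero => simp
    | succ k ih =>
      have h1 : x + ((k + 1 : ℕ) : ℤ) * q = x + k * q + q := by push_cast; ring
      rw [h1]
      refine ⟨?_, by rw [hη, ih.2]⟩
      push_cast
      linarith [ih.1, ih.2]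
  have hinj : Function.Injective fun k : ℕ => (⟨s (x + k * q), hs _⟩ : V) := by
    intro k k' h
    simp only [Subtype.mk.injEq] at h
    rw [(hlin k).1, (hlin k').1] at h
    have : ((k : ℚ) - k') * (s (x + q) - s x) = 0 := by linarith
    rcases mul_eq_zero.1 this with h | h
    · exact_mod_cast sub_eq_zero.1 h
    · exact absurd (sub_eq_zero.1 h) hne
  exact not_injective_infinite_finite _ hinj

/-- Apply a finitely supported family of row correlations to a bi-infinite stack of rows. -/
noncomputable def app (a : ℤ →₀ ℤ →₀ ℚ) (s : ℤ → ℤ → ℚ) (r x : ℤ) : ℚ :=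
  a.sum fun y c => corr c (s (y + r)) x

theorem app_eq_add (a : ℤ →₀ ℤ →₀ ℚ) (s : ℤ → ℤ → ℚ) (r x y₀ : ℤ) :
    app a s r x = corr (a y₀) (s (y₀ + r)) x +
      ∑ y ∈ a.support.erase y₀, corr (a y) (s (y + r)) x := by
  rw [app, Finsupp.sum]
  by_cases h : y₀ ∈ a.support
  · exact (Finset.add_sum_erase _ (fun y => corr (a y) (s (y + r)) x) h).symm
  · rw [Finset.erase_eq_of_notMem h, Finsupp.notMem_support_iff.1 h]
    simp [corr]

/-- In a stack with constant application, periodicity of all rows but one forces the correlation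
with the remaining row to be periodic. -/
theorem corr_periodic_of_app_const {a : ℤ →₀ ℤ →₀ ℚ} {s : ℤ → ℤ → ℚ} {κ : ℚ} {r y₀ q : ℤ}
    (h : ∀ x, app a s r x = κ)
    (hp : ∀ y, a y ≠ 0 → y ≠ y₀ → ∀ x, s (y + r) (x + q) = s (y + r) x) (x : ℤ) :
    corr (a y₀) (s (y₀ + r)) (x + q) = corr (a y₀) (s (y₀ + r)) x := by
  have h1 := app_eq_add a s r (x + q) y₀
  have h2 := app_eq_add a s r x y₀
  rw [h] at h1 h2
  have : ∑ y ∈ a.support.erase y₀, corr (a y) (s (y + r)) (x + q) =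
      ∑ y ∈ a.support.erase y₀, corr (a y) (s (y + r)) x := by
    refine Finset.sum_congr rfl fun y hy => corr_periodic (hp y ?_ ?_) x
    · simpa using Finset.mem_of_mem_erase hy
    · exact Finset.ne_of_mem_erase hy
  linarith

/-- Periodicity of sufficiently many consecutive rows spreads to all rows. -/
theorem exists_row_periodicity_spreads (V : Finset ℚ) {s : ℤ → ℤ → ℚ} (hV : ∀ r x, s r x ∈ V)
    {a : ℤ →₀ ℤ →₀ ℚ} {lo hi : ℤ} (hlo : a lo ≠ 0) (hhi : a hi ≠ 0)
    (ha : ∀ y, a y ≠ 0 → lo ≤ y ∧ y ≤ hi) {κ : ℚ} (h : ∀ r x, app a s r x = κ) :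
    ∃ m₀ : ℕ, 0 < m₀ ∧ ∀ q : ℕ, m₀ ∣ q → ∀ r₀ : ℤ,
      (∀ r, r₀ ≤ r → r < r₀ + (hi - lo) → ∀ x, s r (x + q) = s r x) →
      ∀ r x, s r (x + q) = s r x := by
  obtain ⟨m₁, hm₁, H₁⟩ := exists_periodic_of_corr_periodic V hlo
  obtain ⟨m₂, hm₂, H₂⟩ := exists_periodic_of_corr_periodic V hhi
  refine ⟨m₁ * m₂, Nat.mul_pos hm₁ hm₂, fun q hd r₀ hr₀ => ?_⟩
  have hq₁ : m₁ ∣ q := dvd_trans (dvd_mul_right _ _) hd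
  have hq₂ : m₂ ∣ q := dvd_trans (dvd_mul_left _ _) hd
  have key : ∀ j : ℕ, ∀ r, r₀ - j ≤ r → r < r₀ + (hi - lo) + j → ∀ x, s r (x + q) = s r x := by
    intro j
    induction j with
    | zero => simpa using hr₀
    | succ j ih =>
      intro r h1 h2
      push_cast at h1 h2
      by_cases hr1 : r < r₀ - j
      · have hr : r = lo + (r - lo) := by ring
        rw [hr]
        refine H₁ _ (hV _) q hq₁ fun x => ?_
        refine corr_periodic_of_app_const (h (r - lo)) (fun y hy hne x => ih _ ?_ ?_ x) x
        · have := ha y hy; omega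
        · have := ha y hy; omega
      · by_cases hr2 : r < r₀ + (hi - lo) + j
        · exact ih r (by omega) hr2
        · have hr : r = hi + (r - hi) := by ring
          rw [hr]
          refine H₂ _ (hV _) q hq₂ fun x => ?_
          refine corr_periodic_of_app_const (h (r - hi)) (fun y hy hne x => ih _ ?_ ?_ x) x
          · have := ha y hy; omega
          · have := ha y hy; omega
  intro r
  exact key ((r₀ - r).natAbs + (r₀ + (hi - lo) - r).natAbs + 1) r (by omega) (by omega)

/-- A stack annihilated by `a` whose rows vanish on a strip of sufficient height is periodic from
there on. -/
theorem exists_period_above_vanishing_rows (V : Finset ℚ) {s : ℤ → ℤ → ℚ} (hV : ∀ r x, s r x ∈ V)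
    {a : ℤ →₀ ℤ →₀ ℚ} (ha0 : a ≠ 0) {H : ℤ} (ha : ∀ y y', a y ≠ 0 → a y' ≠ 0 → y - y' < H)
    (h : ∀ r x, app a s r x = 0) (h0 : ∀ r, -H < r → r < 0 → ∀ x, s r x = 0) :
    ∃ P : ℕ, 0 < P ∧ ∀ r, -H < r → ∀ x, s r (x + P) = s r x := by
  have hne : a.support.Nonempty := Finsupp.support_nonempty_iff.2 ha0
  obtain ⟨hi, hhi, hhi'⟩ : ∃ hi, a hi ≠ 0 ∧ ∀ k, a k ≠ 0 → k ≤ hi :=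
    ⟨a.support.max' hne, by simpa using a.support.max'_mem hne,
      fun k hk => a.support.le_max' k (by simpa using hk)⟩
  obtain ⟨P, hP, HP⟩ := exists_periodic_of_corr_periodic V hhi
  refine ⟨P, hP, ?_⟩
  have key : ∀ j : ℕ, ∀ r, -H < r → r < j → ∀ x, s r (x + P) = s r x := by
    intro j
    induction j with
    | zero => intro r h1 h2 x; rw [h0 r h1 (by simpa using h2), h0 r h1 (by simpa using h2)]
    | succ j ih =>
      intro r h1 h2
      push_cast at h2
      by_cases hr : r < j
      · exact ih r h1 hr
      · have hr : r = hi + (r - hi) := by ring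
        rw [hr]
        refine HP _ (hV _) P dvd_rfl fun x => ?_
        refine corr_periodic_of_app_const (h (r - hi)) (fun y hy hne x => ih _ ?_ ?_ x) x
        · have := ha hi y hhi hy; omega
        · have := hhi' y hy; omega
  exact fun r hr => key (r.natAbs + 1) r hr (by omega)

theorem sum_range_shift {f : ℤ → ℚ} {P : ℕ} (hf : ∀ x, f (x + P) = f x) (k : ℤ) :
    ∑ x ∈ Finset.range P, f (x + k) = ∑ x ∈ Finset.range P, f x := by
  have step : ∀ k : ℤ, ∑ x ∈ Finset.range P, f (x + (k + 1)) =
      ∑ x ∈ Finset.range P, f (x + k) := by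
    intro k
    have h1 := Finset.sum_range_succ (fun x : ℕ => f (x + k)) P
    have h2 := Finset.sum_range_succ' (fun x : ℕ => f (x + k)) P
    rw [h1] at h2
    have h3 : f (P + k) = f ((0 : ℕ) + k) := by
      rw [add_comm, hf]; simp
    rw [h3] at h2
    have h4 := add_right_cancel h2
    rw [h4]
    refine Finset.sum_congr rfl fun x _ => ?_
    congr 1; push_cast; ring
  induction k using Int.induction_on with
  | zero => simp
  | succ i ih => rw [step, ih]
  | pred i ih => rw [← ih, ← step]; simp

theorem sum_mul_corr {f g : ℤ → ℚ} {P : ℕ} (hf : ∀ x, f (x + P) = f x)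
    (hg : ∀ x, g (x + P) = g x) (c : ℤ →₀ ℚ) :
    ∑ x ∈ Finset.range P, f x * corr c g x = ∑ x ∈ Finset.range P, corrAdj c f x * g x := by
  simp only [corr, corrAdj, Finsupp.sum, Finset.mul_sum, Finset.sum_mul]
  rw [Finset.sum_comm, Finset.sum_comm (s := Finset.range P)]
  refine Finset.sum_congr rfl fun k _ => ?_
  rw [← sum_range_shift (f := fun x => c k * f (x - k) * g x) (P := P) ?_ k]
  · refine Finset.sum_congr rfl fun x _ => ?_
    simp only [add_sub_cancel_right]; ring
  · intro x
    have := hf (x - k)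
    rw [show x - k + P = x + P - k by ring] at this
    simp only [this, hg]

theorem corr_corrAdj (c c' : ℤ →₀ ℚ) (s : ℤ → ℚ) (x : ℤ) :
    corr c (corrAdj c' s) x = corrAdj c' (corr c s) x := by
  simp only [corr, corrAdj, Finsupp.sum, Finset.mul_sum]
  rw [Finset.sum_comm]
  refine Finset.sum_congr rfl fun k _ => Finset.sum_congr rfl fun l _ => ?_
  rw [show x + l - k = x - k + l by ring]; ring

theorem corrAdj_periodic {c : ℤ →₀ ℚ} {s : ℤ → ℚ} {q : ℤ} (h : ∀ x, s (x + q) = s x) (x : ℤ) :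
    corrAdj c s (x + q) = corrAdj c s x := by
  simp only [corrAdj, Finsupp.sum]
  refine Finset.sum_congr rfl fun k _ => ?_
  rw [show x + q - k = x - k + q by ring, h]

theorem eq_zero_of_sum_sq {f : ℤ → ℚ} {P : ℕ} (hP : 0 < P) (hf : ∀ x, f (x + P) = f x)
    (h : ∑ x ∈ Finset.range P, f x * f x = 0) (x : ℤ) : f x = 0 := by
  have h1 := (Finset.sum_eq_zero_iff_of_nonneg (fun i _ => mul_self_nonneg _)).1 h
  have hP' : (0 : ℤ) < P := by exact_mod_cast hP
  have h2 := Int.emod_nonneg x hP'.ne'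
  have h3 := Int.emod_lt_of_pos x hP'
  have h4 : f (x % P) = f x := by
    have := periodic_of_dvd hf (Dvd.intro (x / P) rfl : (P : ℤ) ∣ P * (x / P)) (x % P)
    rw [← this, Int.emod_add_mul_ediv]
  have h5 := h1 (x % P).toNat (by simp; omega)
  rw [← h4]
  have h6 : (((x % P).toNat : ℕ) : ℤ) = x % P := Int.toNat_of_nonneg h2
  rw [h6] at h5
  exact mul_self_eq_zero.1 h5

/-- On periodic sequences, the kernel of a correlation is contained in that of its adjoint. -/
theorem corrAdj_eq_zero {c : ℤ →₀ ℚ} {s : ℤ → ℚ} {P : ℕ} (hP : 0 < P)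
    (hs : ∀ x, s (x + P) = s x) (h : ∀ x, corr c s x = 0) (x : ℤ) : corrAdj c s x = 0 := by
  refine eq_zero_of_sum_sq hP (corrAdj_periodic hs) ?_ x
  have h1 := sum_mul_corr (corrAdj_periodic (c := c) hs) hs c
  have h2 := sum_mul_corr hs (corrAdj_periodic (c := c) hs) c
  rw [← h2]
  refine Finset.sum_eq_zero fun x _ => ?_
  rw [corr_corrAdj]
  simp [corrAdj, h]

/-- Every row of a relation annihilates the first nonvanishing row above a strip of zeros. -/
theorem corr_row_eq_zero {s : ℤ → ℤ → ℚ} {a : ℤ →₀ ℤ →₀ ℚ} {H : ℤ}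
    (ha : ∀ y y', a y ≠ 0 → a y' ≠ 0 → y - y' < H)
    (h : ∀ r x, app a s r x = 0) (h0 : ∀ r, -H < r → r < 0 → ∀ x, s r x = 0)
    {P : ℕ} (hP : 0 < P) (hs : ∀ r, -H < r → ∀ x, s r (x + P) = s r x) (y x : ℤ) :
    corr (a y) (s 0) x = 0 := by
  by_cases hay : a y = 0
  · simp [hay, corr]
  have hH : 0 < H := by have := ha y y hay hay; omega
  have hs0 := hs 0 (by omega)
  have key : ∀ j : ℕ, ∀ y, (∀ y', a y' ≠ 0 → y' < y + j) → ∀ x, corr (a y) (s 0) x = 0 := by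
    intro j
    induction j using Nat.strong_induction_on with
    | _ j ih =>
    intro y hy x
    by_cases hay : a y = 0
    · simp [hay, corr]
    have hup : ∀ y', y < y' → ∀ x, corr (a y') (s 0) x = 0 := by
      intro y' hy' x
      by_cases hay' : a y' = 0
      · simp [hay', corr]
      have := hy y' hay'
      refine ih (y + j - y').toNat (by omega) y' (fun y'' h'' => ?_) x
      have := hy y'' h''
      omega
    refine eq_zero_of_sum_sq hP (corr_periodic hs0) ?_ x
    have hw : ∀ x, corr (a y) (s 0) x =
        - ∑ y' ∈ a.support.erase y, corr (a y') (s (y' + -y)) x := by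
      intro x
      have := app_eq_add a s (-y) x y
      rw [h, add_neg_cancel] at this
      linarith
    have : ∀ x, corr (a y) (s 0) x * corr (a y) (s 0) x =
        - ∑ y' ∈ a.support.erase y, corr (a y) (s 0) x * corr (a y') (s (y' + -y)) x := by
      intro x
      nth_rewrite 2 [hw x]
      rw [mul_neg, Finset.mul_sum]
    simp only [this]
    rw [Finset.sum_neg_distrib, Finset.sum_comm, neg_eq_zero]
    refine Finset.sum_eq_zero fun y' hy' => ?_
    have hne := Finset.ne_of_mem_erase hy'
    have hay' : a y' ≠ 0 := by simpa using Finset.mem_of_mem_erase hy'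
    have hlt := ha y y' hay hay'
    rcases lt_or_gt_of_ne hne with hlt' | hgt
    · refine Finset.sum_eq_zero fun x _ => ?_
      simp [corr, h0 (y' + -y) (by omega) (by omega)]
    · rw [sum_mul_corr (corr_periodic hs0) (hs _ (by omega))]
      refine Finset.sum_eq_zero fun x _ => ?_
      rw [← corr_corrAdj]
      simp [corr, corrAdj_eq_zero hP hs0 (hup y' hgt)]
  have hne : a.support.Nonempty := ⟨y, by simpa using hay⟩
  refine key (a.support.max' hne - y + 1).toNat y (fun y' hy' => ?_) x
  have := a.support.le_max' y' (by simpa using hy')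
  omega

/-- The smallest window size `b` meeting the support of a nonzero periodic sequence everywhere is
a lower bound for the span of any correlation annihilating the sequence. -/
theorem exists_window {s : ℤ → ℚ} {P : ℕ} (hP : 0 < P) (hs : ∀ x, s (x + P) = s x)
    (hne : ∃ x, s x ≠ 0) :
    ∃ b : ℕ, 0 < b ∧ (∀ x, ∃ k : ℕ, k < b ∧ s (x + k) ≠ 0) ∧
      ∀ c : ℤ →₀ ℚ, c ≠ 0 → (∀ x, corr c s x = 0) → ∃ k k', c k ≠ 0 ∧ c k' ≠ 0 ∧ k + b ≤ k' := by
  classical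
  obtain ⟨x₀, hx₀⟩ := hne
  have hP' : (0 : ℤ) < P := by exact_mod_cast hP
  have hex : ∃ b : ℕ, ∀ x, ∃ k : ℕ, k < b ∧ s (x + k) ≠ 0 := by
    refine ⟨P, fun x => ⟨((x₀ - x) % P).toNat, ?_, ?_⟩⟩
    · have := Int.emod_nonneg (x₀ - x) hP'.ne'
      have := Int.emod_lt_of_pos (x₀ - x) hP'
      omega
    · rw [Int.toNat_of_nonneg (Int.emod_nonneg (x₀ - x) hP'.ne')]
      have := periodic_of_dvd hs (Dvd.intro ((x₀ - x) / P) rfl : (P : ℤ) ∣ P * ((x₀ - x) / P))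
        (x + (x₀ - x) % P)
      rw [← this, add_assoc, Int.emod_add_mul_ediv]
      simpa using hx₀
  have hspec := Nat.find_spec hex
  have hb : 0 < Nat.find hex := by
    obtain ⟨k, hk, -⟩ := hspec 0
    omega
  refine ⟨Nat.find hex, hb, hspec, fun c hc hcs => ?_⟩
  have hmin := Nat.find_min hex (m := Nat.find hex - 1) (by omega)
  push Not at hmin
  obtain ⟨x₁, hx₁⟩ := hmin
  have hlast : s (x₁ + (Nat.find hex - 1 : ℕ)) ≠ 0 := by
    obtain ⟨k, hk, hk'⟩ := hspec x₁
    by_cases h : k < Nat.find hex - 1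
    · exact absurd (hx₁ k h) hk'
    · rwa [show Nat.find hex - 1 = k by omega]
  have hsne : c.support.Nonempty := Finsupp.support_nonempty_iff.2 hc
  have hmaxs : c (c.support.max' hsne) ≠ 0 := by simpa using c.support.max'_mem hsne
  have hmins : c (c.support.min' hsne) ≠ 0 := by simpa using c.support.min'_mem hsne
  refine ⟨c.support.min' hsne, c.support.max' hsne, hmins, hmaxs, ?_⟩
  by_contra hlt
  push Not at hlt
  set M := c.support.max' hsne
  refine hlast ?_
  have := eq_zero_of_corr_eq_zero (x := x₁ + (Nat.find hex - 1 : ℕ) - M) hmaxs (hcs _) ?_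
  · simpa using this
  · intro k hk hkM
    have h1 := c.support.le_max' k (by simpa using hk)
    have h2 := c.support.min'_le k (by simpa using hk)
    have h3 := hx₁ (Nat.find hex - 1 + k - M).toNat
    refine Eq.trans ?_ (h3 (by omega))
    exact congrArg s (by omega)

/-- A lower bound on the number of patterns, from an upper bound `Z.card` on the dimension of the
space of affine relations they satisfy and a space `F` of formal combinations of patterns with
vanishing value. -/
theorem card_add_finrank_le_ncard_patterns {ι A : Type*} [Fintype ι] [Finite A]
    (P : Set (ι → A)) (hP : P.Nonempty) (ψ : A → ℚ) (Z : Finset ι)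
    (hZ : ∀ (g : ι → ℚ) (κ : ℚ), (∀ f ∈ P, ∑ i, g i * ψ (f i) = κ) → (∀ i ∈ Z, g i = 0) → g = 0)
    (F : Submodule ℚ ((ι → A) →₀ ℚ)) (hF : F ≤ Finsupp.supported ℚ ℚ P)
    (hF' : ∀ v ∈ F, Finsupp.linearCombination ℚ
      (fun (f : ι → A) (o : Option ι) => o.elim 1 fun i => ψ (f i)) v = 0) :
    Fintype.card ι + 1 + Module.finrank ℚ F ≤ P.ncard + Z.card := by
  classical
  set Ψ := Finsupp.linearCombination ℚ
      (fun (f : ι → A) (o : Option ι) => o.elim (1 : ℚ) fun i => ψ (f i)) with hΨ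
  set E := Finsupp.supported ℚ ℚ P with hE
  have hEcard : Module.finrank ℚ E = P.ncard := by
    have : Fintype P := Fintype.ofFinite P
    rw [LinearEquiv.finrank_eq (Finsupp.supportedEquivFinsupp P), Module.finrank_finsupp_self,
      ← Nat.card_coe_set_eq, Nat.card_eq_fintype_card]
  have hrn := LinearMap.finrank_range_add_finrank_ker (Ψ.domRestrict E)
  rw [LinearMap.range_domRestrict, hEcard] at hrn
  have hker : Module.finrank ℚ F ≤ Module.finrank ℚ (LinearMap.ker (Ψ.domRestrict E)) := by
    have hcomap : Module.finrank ℚ (F.comap E.subtype) = Module.finrank ℚ F :=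
      LinearEquiv.finrank_eq (Submodule.comapSubtypeEquivOfLe hF)
    rw [← hcomap]
    refine Submodule.finrank_mono fun v hv => ?_
    simpa using hF' _ hv
  have hann := Subspace.finrank_add_finrank_dualAnnihilator_eq (E.map Ψ)
  rw [Module.finrank_fintype_fun_eq_card, Fintype.card_option] at hann
  have hle : Module.finrank ℚ (E.map Ψ).dualAnnihilator ≤ Z.card := by
    let T : (E.map Ψ).dualAnnihilator →ₗ[ℚ] (Z → ℚ) :=
      { toFun := fun φ i => φ.1 (Pi.single (some i.1) 1)
        map_add' := fun _ _ => rfl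
        map_smul' := fun _ _ => rfl }
    have hT : Function.Injective T := by
      rw [← LinearMap.ker_eq_bot, LinearMap.ker_eq_bot']
      intro φ hφ
      have hval : ∀ f ∈ P, φ.1 (Pi.single none 1) +
          ∑ i, φ.1 (Pi.single (some i) 1) * ψ (f i) = 0 := by
        intro f hf
        have h1 := (Submodule.mem_dualAnnihilator _).1 φ.2 (Ψ (Finsupp.single f 1))
          ⟨_, Finsupp.single_mem_supported ℚ _ hf, rfl⟩
        have hΨf : Ψ (Finsupp.single f 1) = fun o => o.elim 1 fun i => ψ (f i) := by
          rw [hΨ, Finsupp.linearCombination_single, one_smul]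
        simp only [hΨf] at h1
        rw [LinearMap.pi_apply_eq_sum_univ φ.1] at h1
        rw [Fintype.sum_option] at h1
        have hs : ∀ o : Option ι, (fun j => if o = j then (1 : ℚ) else 0) = Pi.single o 1 := by
          intro o; ext j; simp [Pi.single_apply, eq_comm]
        simp only [Option.elim, hs, smul_eq_mul, one_mul] at h1
        rw [← h1]
        congr 1
        exact Finset.sum_congr rfl fun i _ => mul_comm _ _
      have hg := hZ (fun i => φ.1 (Pi.single (some i) 1)) (-φ.1 (Pi.single none 1))
        (fun f hf => by linarith [hval f hf]) (fun i hi => congrFun hφ ⟨i, hi⟩)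
      obtain ⟨f, hf⟩ := hP
      have hnone := hval f hf
      have hg' : ∀ i, φ.1 (Pi.single (some i) 1) = 0 := fun i => congrFun hg i
      simp only [hg', zero_mul, Finset.sum_const_zero, add_zero] at hnone
      refine Subtype.ext (LinearMap.pi_ext' fun o => LinearMap.ext_ring ?_)
      cases o with
      | none => simpa using hnone
      | some i => simpa using hg' i
    simpa using LinearMap.finrank_le_finrank_of_injective hT
  omega

/-- Submodularity of dimensions under a linear map. -/
theorem finrank_add_finrank_map_le {V₁ V₂ : Type*} [AddCommGroup V₁] [Module ℚ V₁]
    [AddCommGroup V₂] [Module ℚ V₂] [FiniteDimensional ℚ V₁] (C : V₁ →ₗ[ℚ] V₂)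
    {X X' : Submodule ℚ V₁} (h : X ≤ X') :
    Module.finrank ℚ X + Module.finrank ℚ (X'.map C) ≤
      Module.finrank ℚ X' + Module.finrank ℚ (X.map C) := by
  have h1 := LinearMap.finrank_range_add_finrank_ker (C.domRestrict X)
  have h2 := LinearMap.finrank_range_add_finrank_ker (C.domRestrict X')
  rw [LinearMap.range_domRestrict] at h1 h2
  have h3 : Module.finrank ℚ (LinearMap.ker (C.domRestrict X)) ≤
      Module.finrank ℚ (LinearMap.ker (C.domRestrict X')) := by
    rw [LinearMap.ker_domRestrict, LinearMap.ker_domRestrict,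
      ← Submodule.finrank_map_subtype_eq, ← Submodule.finrank_map_subtype_eq X']
    refine Submodule.finrank_mono ?_
    rintro _ ⟨v, hv, rfl⟩
    exact ⟨⟨v, h v.2⟩, hv, rfl⟩
  omega

/-- If the submodularity inequality is an equality, then elements of the larger space whose image
comes from the smaller space belong to the smaller space. -/
theorem mem_of_map_mem_of_finrank_le {V₁ V₂ : Type*} [AddCommGroup V₁] [Module ℚ V₁]
    [AddCommGroup V₂] [Module ℚ V₂] [FiniteDimensional ℚ V₁] (C : V₁ →ₗ[ℚ] V₂)
    {X X' : Submodule ℚ V₁} (h : X ≤ X')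
    (hle : Module.finrank ℚ X' + Module.finrank ℚ (X.map C) ≤
      Module.finrank ℚ X + Module.finrank ℚ (X'.map C))
    {v : V₁} (hv : v ∈ X') (hCv : C v ∈ X.map C) : v ∈ X := by
  have h1 := LinearMap.finrank_range_add_finrank_ker (C.domRestrict X)
  have h2 := LinearMap.finrank_range_add_finrank_ker (C.domRestrict X')
  rw [LinearMap.range_domRestrict, LinearMap.ker_domRestrict,
      ← Submodule.finrank_map_subtype_eq] at h1 h2
  have h3 : (Submodule.map X.subtype (Submodule.comap X.subtype (LinearMap.ker C))) ≤
      (Submodule.map X'.subtype (Submodule.comap X'.subtype (LinearMap.ker C))) := by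
    rintro _ ⟨v, hv, rfl⟩
    exact ⟨⟨v, h v.2⟩, hv, rfl⟩
  have h4 := Submodule.eq_of_le_of_finrank_le h3 (by omega)
  obtain ⟨w, hw, hwv⟩ := hCv
  have h5 : v - w ∈ Submodule.map X'.subtype (Submodule.comap X'.subtype (LinearMap.ker C)) :=
    ⟨⟨v - w, X'.sub_mem hv (h hw)⟩, by simp [hwv], rfl⟩
  rw [← h4] at h5
  obtain ⟨⟨x, hx⟩, -, hxe⟩ := h5
  have : v = x + w := by
    have : x = v - w := hxe
    rw [this]; abel
  rw [this]
  exact X.add_mem hx hw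

/-- A sequence with finite range whose `q`-differences have shift invariant differences modulo `X`
is periodic modulo `X`. -/
theorem exists_period_mod {V : Type*} [AddCommGroup V] [Module ℚ V] (X : Submodule ℚ V)
    {α : ℤ → V} (hfin : (Set.range α).Finite) {q : ℕ} (hq : 0 < q)
    (hinv : ∀ p t t' : ℤ, (α (t + p) - α (t + p + q)) - (α t - α (t + q)) ∈ X →
      (α (t' + p) - α (t' + p + q)) - (α t' - α (t' + q)) ∈ X) :
    ∃ Q : ℕ, 0 < Q ∧ q ∣ Q ∧ ∀ t, α t - α (t + Q) ∈ X := by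
  have hfin2 : Finite (Set.range α) := hfin
  obtain ⟨i, j, hij, hst⟩ := Finite.exists_ne_map_eq_of_infinite
    (fun i : ℕ => ((⟨α i, i, rfl⟩, ⟨α (i + q), _, rfl⟩) : Set.range α × Set.range α))
  wlog hlt : i < j generalizing i j
  · exact this j i hij.symm hst.symm (lt_of_le_of_ne (not_lt.1 hlt) hij.symm)
  obtain ⟨p, rfl⟩ : ∃ p, j = i + p := ⟨j - i, by omega⟩
  have hst₁ : α i = α (i + p) := by simpa using congrArg (fun z => (z.1 : V)) hst
  have hst₂ : α (i + q) = α (i + p + q) := by simpa using congrArg (fun z => (z.2 : V)) hst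
  have hp : ∀ t : ℤ, (α (t + p) - α (t + p + q)) - (α t - α (t + q)) ∈ X := fun t =>
    hinv p i t (by rw [hst₁, hst₂]; simp)
  have hpk : ∀ (k : ℕ) (t : ℤ), (α (t + p * k) - α (t + p * k + q)) - (α t - α (t + q)) ∈ X := by
    intro k
    induction k with
    | zero => intro t; simp
    | succ k ih =>
      intro t
      have := X.add_mem (ih t) (hp (t + p * k))
      convert this using 1
      rw [show t + (p : ℤ) * (k + 1 : ℕ) = t + p * k + p by push_cast; ring]
      abel
  have hQ : ∀ (k : ℕ) (t : ℤ),
      (α (t + p * q) - α (t + p * q + q * k)) - (α t - α (t + q * k)) ∈ X := by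
    intro k
    induction k with
    | zero => intro t; simp
    | succ k ih =>
      intro t
      have := X.add_mem (ih t) (hpk q (t + q * k))
      convert this using 1
      rw [show t + (p : ℤ) * q + (q : ℤ) * (k + 1 : ℕ) = t + q * k + p * q + q by push_cast; ring,
        show t + (p : ℤ) * q + q * k = t + q * k + p * q by ring,
        show t + (q : ℤ) * (k + 1 : ℕ) = t + q * k + q by push_cast; ring]
      abel
  have hQQ : ∀ t : ℤ, (α (t + p * q) - α (t + p * q + p * q)) - (α t - α (t + p * q)) ∈ X := by
    intro t
    have := hQ p t
    rwa [show (q : ℤ) * p = p * q by ring] at this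
  have hlin : ∀ (k : ℕ) (t : ℤ),
      (α (t + p * q * k) - α (t + p * q * k + p * q)) - (α t - α (t + p * q)) ∈ X := by
    intro k
    induction k with
    | zero => intro t; simp
    | succ k ih =>
      intro t
      have := X.add_mem (ih t) (hQQ (t + p * q * k))
      convert this using 1
      rw [show t + (p : ℤ) * q * (k + 1 : ℕ) = t + p * q * k + p * q by push_cast; ring]
      abel
  have hmul : ∀ (k : ℕ) (t : ℤ),
      (α t - α (t + p * q * k)) - (k : ℚ) • (α t - α (t + p * q)) ∈ X := by
    intro k
    induction k with
    | zero => intro t; simp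
    | succ k ih =>
      intro t
      have := X.add_mem (ih t) (hlin k t)
      convert this using 1
      rw [show t + (p : ℤ) * q * (k + 1 : ℕ) = t + p * q * k + p * q by push_cast; ring]
      push_cast
      rw [add_smul, one_smul]
      abel
  refine ⟨p * q, Nat.mul_pos (by omega) hq, dvd_mul_left _ _, fun t => ?_⟩
  obtain ⟨k, l, hkl, hst⟩ := Finite.exists_ne_map_eq_of_infinite
    (fun k : ℕ => (⟨α (t + p * q * k), _, rfl⟩ : Set.range α))
  have hst' : α (t + p * q * k) = α (t + p * q * l) := congrArg Subtype.val hst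
  have h := X.sub_mem (hmul k t) (hmul l t)
  rw [hst', sub_sub_sub_cancel_left, ← sub_smul] at h
  have hne : (l : ℚ) - k ≠ 0 := sub_ne_zero.2 (by exact_mod_cast hkl.symm)
  push_cast
  exact (X.smul_mem_iff hne).1 h

/-- For a decreasing sequence of finite sets of integers which is eventually empty, there is a
window of length `n` which contains every set of the sequence or fits between two elements
of it. -/
theorem exists_window_of_antitone {Y : ℕ → Finset ℤ} (hY : Antitone Y) (hJ : ∃ J, Y J = ∅)
    (n : ℕ) : ∃ w : ℤ, ∀ j, (∀ y ∈ Y j, w ≤ y ∧ y < w + n) ∨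
      ∃ mn ∈ Y j, ∃ mx ∈ Y j, mn ≤ w ∧ w + n ≤ mx + 1 := by
  classical
  have hex : ∃ j, ∃ w : ℤ, ∀ y ∈ Y j, w ≤ y ∧ y < w + n := by
    obtain ⟨J, hJ⟩ := hJ
    exact ⟨J, 0, by simp [hJ]⟩
  obtain ⟨w, hw⟩ := Nat.find_spec hex
  rcases Nat.eq_zero_or_pos (Nat.find hex) with h0 | hpos
  · rw [h0] at hw
    exact ⟨w, fun j => Or.inl fun y hy => hw y (hY (Nat.zero_le j) hy)⟩
  have hmin := Nat.find_min hex (m := Nat.find hex - 1) (by omega)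
  push Not at hmin
  set Y' := Y (Nat.find hex - 1) with hY'
  have hne : Y'.Nonempty := by
    obtain ⟨y, hy, -⟩ := hmin 0
    exact ⟨y, hy⟩
  have hmn := Y'.min'_mem hne
  have hmx := Y'.max'_mem hne
  set mn := Y'.min' hne with hmn'
  set mx := Y'.max' hne with hmx'
  have hlen : mn + n ≤ mx := by
    obtain ⟨y, hy, hy'⟩ := hmin mn
    have h1 := hy' (Y'.min'_le y hy)
    have h2 := Y'.le_max' y hy
    omega
  refine ⟨max mn (min w (mx - n + 1)), fun j => ?_⟩
  by_cases hj : Nat.find hex ≤ j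
  · left
    intro y hy
    have h1 := hw y (hY hj hy)
    have hyY : y ∈ Y' := hY (by omega) hy
    have h2 := Y'.min'_le y hyY
    have h3 := Y'.le_max' y hyY
    omega
  · right
    have hsub : Y' ⊆ Y j := hY (by omega)
    exact ⟨mn, hsub hmn, mx, hsub hmx, by omega, by omega⟩

theorem app_congr {a : ℤ →₀ ℤ →₀ ℚ} {s s' : ℤ → ℤ → ℚ} {r x r' x' : ℤ}
    (h : ∀ y k, a y k ≠ 0 → s (y + r) (x + k) = s' (y + r') (x' + k)) :
    app a s r x = app a s' r' x' := by
  simp only [app, corr, Finsupp.sum]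
  refine Finset.sum_congr rfl fun y _ => Finset.sum_congr rfl fun k hk => ?_
  rw [h y k (by simpa using hk)]

theorem app_sub (a : ℤ →₀ ℤ →₀ ℚ) (s s' : ℤ → ℤ → ℚ) (r x : ℤ) :
    app a (fun r x => s r x - s' r x) r x = app a s r x - app a s' r x := by
  simp only [app, corr_sub, Finsupp.sum, Finset.sum_sub_distrib]

/-- The rows of a finitely supported function on the plane. -/
noncomputable def toRows (g : ℤ × ℤ →₀ ℚ) : ℤ →₀ ℤ →₀ ℚ :=
  (g.equivMapDomain (Equiv.prodComm ℤ ℤ)).curry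

theorem toRows_apply (g : ℤ × ℤ →₀ ℚ) (y x : ℤ) : toRows g y x = g (x, y) := by
  simp [toRows, Finsupp.curry_apply]

theorem app_toRows (g : ℤ × ℤ →₀ ℚ) (s : ℤ → ℤ → ℚ) (r x : ℤ) :
    app (toRows g) s r x = g.sum fun z v => v * s (z.2 + r) (x + z.1) := by
  have h := Finsupp.sum_curry_index (g.equivMapDomain (Equiv.prodComm ℤ ℤ))
    (fun y k v => v * s (y + r) (x + k))
  rw [app, toRows]
  simp only [corr]
  rw [h, Finsupp.equivMapDomain_eq_mapDomain, Finsupp.sum_mapDomain_index (by simp)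
    (by intros; ring)]
  rfl

/-- If relations exist, some relation occupies the least possible number `n + 1` of rows. -/
theorem exists_minimal_relation {R : (ℤ →₀ ℤ →₀ ℚ) → Prop} (h : ∃ a, R a ∧ a ≠ 0) :
    ∃ n : ℕ, (∀ a, R a → ∀ w : ℤ, (∀ y, a y ≠ 0 → w ≤ y ∧ y < w + n) → a = 0) ∧
      ∃ a, R a ∧ ∃ lo : ℤ, a lo ≠ 0 ∧ a (lo + n) ≠ 0 ∧ ∀ y, a y ≠ 0 → lo ≤ y ∧ y ≤ lo + n := by
  classical
  have span : ∀ a : ℤ →₀ ℤ →₀ ℚ, a ≠ 0 → ∃ (n : ℕ) (lo : ℤ), a lo ≠ 0 ∧ a (lo + n) ≠ 0 ∧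
      ∀ y, a y ≠ 0 → lo ≤ y ∧ y ≤ lo + n := by
    intro a ha
    have hne : a.support.Nonempty := Finsupp.support_nonempty_iff.2 ha
    have h1 := a.support.min'_le _ (a.support.max'_mem hne)
    have h2 : a.support.min' hne + ((a.support.max' hne - a.support.min' hne).toNat : ℕ) =
      a.support.max' hne := by omega
    refine ⟨(a.support.max' hne - a.support.min' hne).toNat, a.support.min' hne, ?_, ?_, ?_⟩
    · simpa using a.support.min'_mem hne
    · rw [h2]; simpa using a.support.max'_mem hne
    · intro y hy
      rw [h2]
      exact ⟨a.support.min'_le y (by simpa using hy), a.support.le_max' y (by simpa using hy)⟩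
  have hex : ∃ n : ℕ, ∃ a, R a ∧ ∃ lo : ℤ, a lo ≠ 0 ∧ a (lo + n) ≠ 0 ∧
      ∀ y, a y ≠ 0 → lo ≤ y ∧ y ≤ lo + n := by
    obtain ⟨a, haR, ha⟩ := h
    obtain ⟨n, lo, h⟩ := span a ha
    exact ⟨n, a, haR, lo, h⟩
  refine ⟨Nat.find hex, fun a haR w hw => ?_, Nat.find_spec hex⟩
  by_contra ha
  obtain ⟨n, lo, h⟩ := span a ha
  have hle := Nat.find_min' hex ⟨a, haR, lo, h⟩
  have h1 := hw _ h.1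
  have h2 := hw _ h.2.1
  omega

/-- The constraints extracted from a nonzero affine relation supported on `D`: `n + 1` is the
least number of rows of a relation, `b` a lower bound for the span of the rows of relations. -/
theorem exists_relation_constants {A : Type*} [Finite A] {ψ : A → ℚ} (hψ : Function.Injective ψ)
    {d e : ℤ × ℤ → A} {D : Finset (ℤ × ℤ)} {H : ℤ}
    (hH : ∀ z ∈ D, ∀ z' ∈ D, z.2 - z'.2 < H)
    (hagree : ∀ x r, -H < r → r < 0 → d (x, r) = e (x, r))
    (hdiff : ∃ x, d (x, 0) ≠ e (x, 0))
    (hcl : ∀ (F : Finset (ℤ × ℤ)) (t : ℤ × ℤ), ∃ t', ∀ z ∈ F, e (z + t) = d (z + t'))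
    {g : ℤ × ℤ →₀ ℚ} (hg : g ≠ 0) (hgD : ↑g.support ⊆ (D : Set (ℤ × ℤ))) {κ : ℚ}
    (hrel : ∀ r x, app (toRows g) (fun r x => ψ (d (x, r))) r x = κ) :
    ∃ n b q : ℕ, 0 < b ∧ 0 < q ∧
      (∀ (g : ℤ × ℤ →₀ ℚ) (κ : ℚ), (∀ r x, app (toRows g) (fun r x => ψ (d (x, r))) r x = κ) →
        ∀ w : ℤ, (∀ z, g z ≠ 0 → w ≤ z.2 ∧ z.2 < w + n) → g = 0) ∧
      (∀ Q : ℕ, q ∣ Q → ∀ r₀ : ℤ, (∀ r, r₀ ≤ r → r < r₀ + n → ∀ x, d (x + Q, r) = d (x, r)) →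
        ∀ r x, d (x + Q, r) = d (x, r)) ∧
      (∀ r, -H < r → ∀ x, ψ (d (x + q, r)) - ψ (e (x + q, r)) = ψ (d (x, r)) - ψ (e (x, r))) ∧
      (∀ x, ∃ k : ℕ, k < b ∧ d (x + k, 0) ≠ e (x + k, 0)) ∧
      (∀ (g : ℤ × ℤ →₀ ℚ) (κ : ℚ), ↑g.support ⊆ (D : Set (ℤ × ℤ)) →
        (∀ r x, app (toRows g) (fun r x => ψ (d (x, r))) r x = κ) →
        ∀ z, g z ≠ 0 → ∃ k k', g (k, z.2) ≠ 0 ∧ g (k', z.2) ≠ 0 ∧ k + b ≤ k') := by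
  classical
  have : Fintype A := Fintype.ofFinite A
  have hrows : ∀ g : ℤ × ℤ →₀ ℚ, g ≠ 0 → toRows g ≠ 0 := by
    intro g hg h
    refine hg (Finsupp.ext fun z => ?_)
    rw [show z = (z.1, z.2) from rfl, ← toRows_apply, h]; simp
  have hheight : ∀ g : ℤ × ℤ →₀ ℚ, ↑g.support ⊆ (D : Set (ℤ × ℤ)) →
      ∀ y y', toRows g y ≠ 0 → toRows g y' ≠ 0 → y - y' < H := by
    intro g hgD y y' hy hy'
    obtain ⟨k, hk⟩ := Finsupp.ne_iff.1 hy
    obtain ⟨k', hk'⟩ := Finsupp.ne_iff.1 hy'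
    rw [toRows_apply] at hk hk'
    exact hH _ (hgD (by simpa using hk)) _ (hgD (by simpa using hk'))
  set δ : ℤ → ℤ → ℚ := fun r x => ψ (d (x, r)) - ψ (e (x, r)) with hδ
  have hann : ∀ (a : ℤ →₀ ℤ →₀ ℚ) (κ : ℚ), (∀ r x, app a (fun r x => ψ (d (x, r))) r x = κ) →
      ∀ r x, app a δ r x = 0 := by
    intro a κ ha r x
    rw [hδ, app_sub a (fun r x => ψ (d (x, r))) (fun r x => ψ (e (x, r))), ha]
    obtain ⟨t', ht'⟩ := hcl (a.support.biUnion fun y => (a y).support.image fun k => (k, y)) (x, r)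
    rw [sub_eq_zero, ← ha t'.2 t'.1]
    refine app_congr fun y k hk => ?_
    have h1 : a y ≠ 0 := fun h => hk (by simp [h])
    have h2 := ht' (k, y) (by simp [hk, h1])
    simp only [Prod.mk_add_mk] at h2
    rw [add_comm x k, h2, add_comm t'.1 k]
    rfl
  set V : Finset ℚ := Finset.univ.image ψ with hV
  have hVd : ∀ r x, ψ (d (x, r)) ∈ V := fun r x => by simp [hV]
  have hδV : ∀ r x, δ r x ∈ Finset.image₂ (fun a b => a - b) V V := fun r x =>
    Finset.mem_image₂.2 ⟨_, hVd r x, ψ (e (x, r)), by simp [hV], rfl⟩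
  have hδ0 : ∀ r, -H < r → r < 0 → ∀ x, δ r x = 0 := fun r h1 h2 x => by
    simp [hδ, hagree x r h1 h2]
  obtain ⟨P, hP, hper⟩ := exists_period_above_vanishing_rows _ hδV (hrows g hg) (hheight g hgD)
    (hann _ κ hrel) hδ0
  have hH0 : 0 < H := by
    obtain ⟨z, hz⟩ := Finsupp.ne_iff.1 hg
    have hzD := hgD (show z ∈ ↑g.support by simpa using hz)
    have := hH z hzD z hzD
    omega
  obtain ⟨b, hb, hwin, hspan⟩ := exists_window hP (hper 0 (by omega)) (by
    obtain ⟨x, hx⟩ := hdiff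
    exact ⟨x, sub_ne_zero.2 fun h => hx (hψ h)⟩)
  obtain ⟨n, hmin, a, ⟨κ', haκ⟩, lo, hlo, hhi, hlohi⟩ := exists_minimal_relation
    (R := fun a => ∃ κ, ∀ r x, app a (fun r x => ψ (d (x, r))) r x = κ)
    ⟨toRows g, ⟨κ, hrel⟩, hrows g hg⟩
  obtain ⟨m, hm, hspread⟩ := exists_row_periodicity_spreads V
    (s := fun r x => ψ (d (x, r))) hVd hlo hhi hlohi haκ
  refine ⟨n, b, m * P, hb, Nat.mul_pos hm hP, ?_, ?_, ?_, ?_, ?_⟩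
  · intro g κ hrel w hw
    by_contra hg
    refine hrows g hg (hmin _ ⟨κ, hrel⟩ w fun y hy => ?_)
    obtain ⟨k, hk⟩ := Finsupp.ne_iff.1 hy
    rw [toRows_apply] at hk
    exact hw (k, y) (by simpa using hk)
  · intro Q hQ r₀ hr₀ r x
    refine hψ (hspread Q (dvd_trans (dvd_mul_right _ _) hQ) r₀ (fun r h1 h2 x => ?_) r x)
    simp only [hr₀ r h1 (by omega) x]
  · intro r hr x
    have := periodic_of_dvd (hper r hr)
      (Int.natCast_dvd_natCast.2 (dvd_mul_left P m)) x
    simpa [hδ] using this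
  · intro x
    obtain ⟨k, hk, hne⟩ := hwin x
    exact ⟨k, hk, fun h => hne (by simp [hδ, h])⟩
  · intro g κ hgD hrel z hz
    have h0 : toRows g z.2 ≠ 0 := fun h => hz (by
      rw [show z = (z.1, z.2) from rfl, ← toRows_apply, h]; simp)
    obtain ⟨k, k', h1, h2, h3⟩ := hspan _ h0
      (corr_row_eq_zero (hheight g hgD) (hann _ κ hrel) hδ0 hP hper z.2)
    rw [toRows_apply] at h1 h2
    exact ⟨k, k', h1, h2, h3⟩

/-- Formal combinations of configurations. -/
abbrev FormalConf (A : Type*) := (ℤ × ℤ → A) →₀ ℚ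

/-- Restriction of formal combinations of configurations to a finite window. -/
noncomputable def pat (A : Type*) (G : Finset (ℤ × ℤ)) :
    FormalConf A →ₗ[ℚ] ((G → A) →₀ ℚ) :=
  Finsupp.lmapDomain ℚ ℚ fun c z => c z

/-- Translation of formal combinations of configurations. -/
noncomputable def formalShift (A : Type*) (v : ℤ × ℤ) : FormalConf A →ₗ[ℚ] FormalConf A :=
  Finsupp.lmapDomain ℚ ℚ fun c z => c (z + v)

/-- The formal difference of two configurations translated by a common vector. -/
noncomputable def formalDiff {A : Type*} (d e : ℤ × ℤ → A) (v : ℤ × ℤ) : FormalConf A :=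
  Finsupp.single (fun z => d (z + v)) 1 - Finsupp.single (fun z => e (z + v)) 1

/-- The space spanned by the `q`-differences of the formal differences at heights `y, …, y₁`. -/
noncomputable def diffSpace {A : Type*} (d e : ℤ × ℤ → A) (q : ℕ) (y₁ y : ℤ) :
    Submodule ℚ (FormalConf A) :=
  Submodule.span ℚ {m | ∃ t y' : ℤ, y ≤ y' ∧ y' ≤ y₁ ∧
    m = formalDiff d e (t, -y') - formalDiff d e (t + q, -y')}

theorem pat_single {A : Type*} (G : Finset (ℤ × ℤ)) (c : ℤ × ℤ → A) (r : ℚ) :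
    pat A G (Finsupp.single c r) = Finsupp.single (fun z : G => c z) r := by
  simp [pat]

theorem formalShift_formalDiff {A : Type*} (d e : ℤ × ℤ → A) (v w : ℤ × ℤ) :
    formalShift A v (formalDiff d e w) = formalDiff d e (v + w) := by
  rw [formalDiff, formalDiff, map_sub]
  simp [formalShift, add_assoc]

theorem exists_factor_pat (A : Type*) {G G' : Finset (ℤ × ℤ)} {v : ℤ × ℤ}
    (h : ∀ z ∈ G', z + v ∈ G) :
    ∃ C : ((G → A) →₀ ℚ) →ₗ[ℚ] ((G' → A) →₀ ℚ), C ∘ₗ pat A G = pat A G' ∘ₗ formalShift A v := by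
  refine ⟨Finsupp.lmapDomain ℚ ℚ fun f z => f ⟨z + v, h z z.2⟩, ?_⟩
  refine Finsupp.lhom_ext fun c r => ?_
  simp [pat, formalShift]

theorem formalShift_zero (A : Type*) : formalShift A 0 = LinearMap.id := by
  refine Finsupp.lhom_ext fun c r => ?_
  simp [formalShift]

theorem diffSpace_antitone {A : Type*} (d e : ℤ × ℤ → A) (q : ℕ) (y₁ : ℤ) :
    Antitone (diffSpace d e q y₁) := by
  intro y y' h
  refine Submodule.span_mono ?_
  rintro _ ⟨t, y'', h1, h2, rfl⟩
  exact ⟨t, y'', h.trans h1, h2, rfl⟩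

theorem diffSpace_eq_bot {A : Type*} (d e : ℤ × ℤ → A) (q : ℕ) {y₁ y : ℤ} (h : y₁ < y) :
    diffSpace d e q y₁ y = ⊥ := by
  rw [diffSpace, Submodule.span_eq_bot]
  rintro _ ⟨t, y', h1, h2, rfl⟩
  omega

theorem map_formalShift_diffSpace {A : Type*} (d e : ℤ × ℤ → A) (q : ℕ) (y₁ y : ℤ) :
    (diffSpace d e q y₁ y).map (formalShift A (1, 0)) = diffSpace d e q y₁ y := by
  rw [diffSpace, Submodule.map_span]
  congr 1
  ext m
  constructor
  · rintro ⟨_, ⟨t, y', h1, h2, rfl⟩, rfl⟩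
    refine ⟨t + 1, y', h1, h2, ?_⟩
    simp only [map_sub, formalShift_formalDiff, Prod.mk_add_mk, zero_add]
    rw [add_comm 1 t, show 1 + (t + (q : ℤ)) = t + 1 + q by ring]
  · rintro ⟨t, y', h1, h2, rfl⟩
    refine ⟨_, ⟨t - 1, y', h1, h2, rfl⟩, ?_⟩
    simp only [map_sub, formalShift_formalDiff, Prod.mk_add_mk, zero_add]
    rw [show 1 + (t - 1) = t by ring, show 1 + (t - 1 + (q : ℤ)) = t + q by ring]

/-- In the equality case of submodularity for two maps which are intertwined by `σ`, membership in
the smaller space is invariant under `σ`. -/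
theorem map_mem_iff_of_finrank_le {M V₁ V₂ : Type*} [AddCommGroup M] [Module ℚ M]
    [AddCommGroup V₁] [Module ℚ V₁] [AddCommGroup V₂] [Module ℚ V₂] [FiniteDimensional ℚ V₁]
    {α : M →ₗ[ℚ] V₁} {C C' : V₁ →ₗ[ℚ] V₂} {σ : M →ₗ[ℚ] M} (hC : C' ∘ₗ α = C ∘ₗ α ∘ₗ σ)
    {Ω Ω' : Submodule ℚ M} (h : Ω ≤ Ω') (hσ : Ω.map σ = Ω) (hσ' : Ω'.map σ = Ω')
    (hle : Module.finrank ℚ (Ω'.map α) + Module.finrank ℚ ((Ω.map α).map C) ≤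
      Module.finrank ℚ (Ω.map α) + Module.finrank ℚ ((Ω'.map α).map C))
    {v : M} (hv : v ∈ Ω') : α (σ v) ∈ Ω.map α ↔ α v ∈ Ω.map α := by
  have hCC : ∀ U : Submodule ℚ M, U.map σ = U → (U.map α).map C' = (U.map α).map C := by
    intro U hU
    rw [← Submodule.map_comp, hC, Submodule.map_comp, Submodule.map_comp, hU]
  have happ : ∀ v, C' (α v) = C (α (σ v)) := fun v => LinearMap.congr_fun hC v
  have hle' : Module.finrank ℚ (Ω'.map α) + Module.finrank ℚ ((Ω.map α).map C') ≤
      Module.finrank ℚ (Ω.map α) + Module.finrank ℚ ((Ω'.map α).map C') := by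
    rwa [hCC _ hσ, hCC _ hσ']
  have hσv : σ v ∈ Ω' := hσ' ▸ Submodule.mem_map_of_mem hv
  constructor
  · intro hmem
    refine mem_of_map_mem_of_finrank_le C' (Submodule.map_mono h) hle'
      (Submodule.mem_map_of_mem hv) ?_
    rw [hCC _ hσ, happ]
    exact Submodule.mem_map_of_mem hmem
  · intro hmem
    refine mem_of_map_mem_of_finrank_le C (Submodule.map_mono h) hle
      (Submodule.mem_map_of_mem hσv) ?_
    rw [← hCC _ hσ, ← happ]
    exact Submodule.mem_map_of_mem hmem

/-- Passing to a smaller window does not increase the dimension gained at height `y`. -/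
theorem finrank_diffSpace_le {A : Type*} [Finite A] (d e : ℤ × ℤ → A) {G G' : Finset (ℤ × ℤ)}
    (hG : G' ⊆ G) (q : ℕ) (y₁ y : ℤ) :
    Module.finrank ℚ ((diffSpace d e q y₁ (y + 1)).map (pat A G)) +
        Module.finrank ℚ ((diffSpace d e q y₁ y).map (pat A G')) ≤
      Module.finrank ℚ ((diffSpace d e q y₁ y).map (pat A G)) +
        Module.finrank ℚ ((diffSpace d e q y₁ (y + 1)).map (pat A G')) := by
  obtain ⟨C, hC⟩ := exists_factor_pat A (G := G) (G' := G') (v := 0)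
    (fun z hz => by simpa using hG hz)
  rw [formalShift_zero, LinearMap.comp_id] at hC
  rw [← hC, Submodule.map_comp, Submodule.map_comp]
  exact finrank_add_finrank_map_le C
    (Submodule.map_mono (diffSpace_antitone d e q y₁ (by omega)))

/-- At heights surrounded by the window, passing to the smaller window strictly decreases the
dimension gained, unless the rows of `d` seen in the window are periodic. -/
theorem finrank_diffSpace_lt {A : Type*} [Finite A] {d e : ℤ × ℤ → A} {H : ℤ}
    (hagree : ∀ x r, -H < r → r < 0 → d (x, r) = e (x, r))
    {G G' : Finset (ℤ × ℤ)} (hG : G' ⊆ G) (hG' : ∀ z ∈ G', z + (1, 0) ∈ G)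
    {q b : ℕ} (hq : 0 < q) (hb : 0 < b) {y₁ y y₂ : ℤ} (hy₁ : y ≤ y₁) (hy₂ : y₂ ≤ y)
    (hH : y₁ - y₂ < H)
    (hwin : ∀ x, ∃ k : ℕ, k < b ∧ d (x + k, 0) ≠ e (x + k, 0))
    (hfull : ∀ r, y₂ ≤ r → r ≤ y → ∃ x : ℤ, ∀ k : ℕ, k < b → (x + k, r) ∈ G)
    (hper : ∀ Q : ℕ, 0 < Q → q ∣ Q →
      ¬ ∀ r, y₂ - y ≤ r → r ≤ 0 → ∀ x, d (x + Q, r) = d (x, r)) :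
    Module.finrank ℚ ((diffSpace d e q y₁ (y + 1)).map (pat A G)) +
        Module.finrank ℚ ((diffSpace d e q y₁ y).map (pat A G')) <
      Module.finrank ℚ ((diffSpace d e q y₁ y).map (pat A G)) +
        Module.finrank ℚ ((diffSpace d e q y₁ (y + 1)).map (pat A G')) := by
  classical
  by_contra! hle
  obtain ⟨C, hC⟩ := exists_factor_pat A (G := G) (G' := G') (v := 0)
    (fun z hz => by simpa using hG hz)
  obtain ⟨C', hC'⟩ := exists_factor_pat A (G := G) (G' := G') (v := (1, 0)) hG'
  rw [formalShift_zero, LinearMap.comp_id] at hC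
  rw [← hC, LinearMap.comp_assoc] at hC'
  rw [← hC, Submodule.map_comp, Submodule.map_comp] at hle
  have hanti := diffSpace_antitone d e q y₁ (show y ≤ y + 1 by omega)
  set X := (diffSpace d e q y₁ (y + 1)).map (pat A G) with hX
  set α : ℤ → ((G → A) →₀ ℚ) := fun t => pat A G (formalDiff d e (t, -y)) with hα
  have hfin : (Set.range α).Finite := by
    have : Set.range α ⊆ Set.range fun p : (G → A) × (G → A) =>
        (Finsupp.single p.1 (1 : ℚ) - Finsupp.single p.2 1) := by
      rintro _ ⟨t, rfl⟩
      exact ⟨(fun z => d (z + (t, -y)), fun z => e (z + (t, -y))), by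
        simp [hα, formalDiff, map_sub, pat_single]⟩
    exact (Set.finite_range _).subset this
  have hgen : ∀ t : ℤ, formalDiff d e (t, -y) - formalDiff d e (t + q, -y) ∈
      diffSpace d e q y₁ y := fun t => Submodule.subset_span ⟨t, y, le_rfl, hy₁, rfl⟩
  have hstep : ∀ p t : ℤ, (α (t + 1 + p) - α (t + 1 + p + q)) - (α (t + 1) - α (t + 1 + q)) ∈ X ↔
      (α (t + p) - α (t + p + q)) - (α t - α (t + q)) ∈ X := by
    intro p t
    have h := map_mem_iff_of_finrank_le hC' hanti (map_formalShift_diffSpace d e q y₁ (y + 1))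
      (map_formalShift_diffSpace d e q y₁ y) hle
      (Submodule.sub_mem _ (hgen (t + p)) (hgen t))
    simp only [map_sub, formalShift_formalDiff, Prod.mk_add_mk, zero_add] at h
    rw [← hX] at h
    simp only [hα]
    rw [← h, show 1 + (t + p) = t + 1 + p by ring, show 1 + (t + p + (q : ℤ)) = t + 1 + p + q by ring,
      show 1 + (t + (q : ℤ)) = t + 1 + q by ring, add_comm 1 t]
  obtain ⟨Q, hQ, hqQ, hmod⟩ := exists_period_mod X hfin hq (fun p t t' ht => by
    have key : ∀ k : ℤ, (α (t + k + p) - α (t + k + p + q)) - (α (t + k) - α (t + k + q)) ∈ X := by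
      intro k
      induction k using Int.induction_on with
      | zero => simpa using ht
      | succ i ih =>
        rw [← add_assoc]
        exact (hstep p _).2 ih
      | pred i ih =>
        refine (hstep p _).1 ?_
        rw [show t + (-(i : ℤ) - 1) + 1 = t + -i by ring]
        exact ih
    have := key (t' - t)
    rwa [add_sub_cancel] at this)
  refine hper Q hQ hqQ fun r hr₁ hr₂ x => ?_
  set I := G.filter fun z => y₂ ≤ z.2 ∧ z.2 ≤ y with hI
  obtain ⟨R, hR⟩ := exists_factor_pat A (G := G) (G' := I) (v := 0)
    (fun z hz => by simpa using (Finset.mem_filter.1 hz).1)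
  rw [formalShift_zero, LinearMap.comp_id] at hR
  have hRX : ∀ v ∈ X, R v = 0 := by
    rintro _ ⟨m, hm, rfl⟩
    have : diffSpace d e q y₁ (y + 1) ≤ LinearMap.ker (pat A I) := by
      refine Submodule.span_le.2 ?_
      rintro _ ⟨t, y', h1, h2, rfl⟩
      have hz : ∀ t : ℤ, pat A I (formalDiff d e (t, -y')) = 0 := by
        intro t
        rw [formalDiff, map_sub, pat_single, pat_single, sub_eq_zero]
        congr 1
        ext z
        have hz := (Finset.mem_filter.1 z.2).2
        exact hagree _ _ (by simp; omega) (by simp; omega)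
      simp [hz]
    have hm' : pat A I m = 0 := this hm
    rw [← hm', ← hR]
    rfl
  obtain ⟨x₁, hx₁⟩ := hfull (r + y) (by omega) (by omega)
  set t := x - x₁ with ht
  have hRt := hRX _ (hmod t)
  have hRα : ∀ t : ℤ, R (α t) = pat A I (formalDiff d e (t, -y)) := fun t =>
    LinearMap.congr_fun hR _
  rw [map_sub, hRα, hRα] at hRt
  simp only [formalDiff, map_sub, pat_single] at hRt
  set f : I → A := fun z => d (z + (t, -y)) with hf
  set g : I → A := fun z => e (z + (t, -y)) with hg
  have hfg : g ≠ f := by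
    obtain ⟨x₂, hx₂⟩ := hfull y hy₂ le_rfl
    obtain ⟨k, hk, hne⟩ := hwin (x₂ + t)
    intro h
    have := congrFun h ⟨(x₂ + k, y), by simp [hI, hx₂ k hk, hy₂]⟩
    simp only [hf, hg, Prod.mk_add_mk, add_neg_cancel] at this
    rw [show x₂ + (k : ℤ) + t = x₂ + t + k by ring] at this
    exact hne this.symm
  have hff : (fun z : I => d (z + (t + (Q : ℤ), -y))) = f := by
    by_contra hne
    have h1 := DFunLike.congr_fun hRt f
    simp only [Finsupp.coe_sub, Pi.sub_apply, Finsupp.single_eq_same, Finsupp.coe_zero,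
      Pi.zero_apply, Finsupp.single_apply, hfg, hne, if_false] at h1
    split_ifs at h1 <;> norm_num at h1
  have := congrFun hff ⟨(x₁, r + y), by
    have := hx₁ 0 hb
    simp only [Nat.cast_zero, add_zero] at this
    simp [hI, this]; omega⟩
  simp only [hf, Prod.mk_add_mk, add_neg_cancel_right] at this
  rwa [show x₁ + (t + (Q : ℤ)) = x + Q by rw [ht]; ring, show x₁ + t = x by rw [ht]; ring] at this

theorem add_card_le_of_forall_step {f g : ℤ → ℕ} {y₀ y₁ : ℤ} (hy : y₀ ≤ y₁ + 1) (V : Finset ℤ)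
    (hV : ∀ y ∈ V, y₀ ≤ y ∧ y ≤ y₁) (h1 : g (y₁ + 1) ≤ f (y₁ + 1))
    (hle : ∀ y, f (y + 1) + g y ≤ f y + g (y + 1))
    (hlt : ∀ y ∈ V, f (y + 1) + g y < f y + g (y + 1)) : g y₀ + V.card ≤ f y₀ := by
  have key : ∀ k : ℕ, g (y₁ + 1 - k) + (V.filter (y₁ + 1 - k ≤ ·)).card ≤ f (y₁ + 1 - k) := by
    intro k
    induction k with
    | zero =>
      have : V.filter (y₁ + 1 ≤ ·) = ∅ := by
        refine Finset.filter_eq_empty_iff.2 fun y hy => ?_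
        have := hV y hy
        omega
      simp only [Nat.cast_zero, sub_zero, this, Finset.card_empty, add_zero]
      exact h1
    | succ k ih =>
      set y := y₁ + 1 - (k + 1 : ℕ) with hy
      have hyk : y₁ + 1 - (k : ℤ) = y + 1 := by rw [hy]; push_cast; ring
      rw [hyk] at ih
      have h2 := hle y
      by_cases hyV : y ∈ V
      · have h3 := hlt y hyV
        have h4 : V.filter (y ≤ ·) ⊆ insert y (V.filter (y + 1 ≤ ·)) := by
          intro z hz
          simp only [Finset.mem_filter, Finset.mem_insert] at hz ⊢
          have := hz.1
          by_cases h : z = y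
          · exact Or.inl h
          · exact Or.inr ⟨hz.1, by omega⟩
        have h5 := (Finset.card_le_card h4).trans (Finset.card_insert_le _ _)
        omega
      · have h4 : V.filter (y ≤ ·) ⊆ V.filter (y + 1 ≤ ·) := by
          intro z hz
          simp only [Finset.mem_filter] at hz ⊢
          have : z ≠ y := fun h => hyV (h ▸ hz.1)
          exact ⟨hz.1, by omega⟩
        have h5 := Finset.card_le_card h4
        omega
  have := key (y₁ + 1 - y₀).toNat
  rw [Int.toNat_of_nonneg (by omega), show y₁ + 1 - (y₁ + 1 - y₀) = y₀ by ring] at this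
  rwa [Finset.filter_true_of_mem fun y hy => (hV y hy).1] at this

theorem exists_finsupp_relation {A : Type*} {d : ℤ × ℤ → A} {D : Finset (ℤ × ℤ)} {ψ : A → ℚ}
    {g : D → ℚ} {κ : ℚ}
    (h : ∀ f ∈ {f : D → A | ∃ t : ℤ × ℤ, ∀ z : D, f z = d (z + t)}, ∑ i, g i * ψ (f i) = κ) :
    ∃ g' : ℤ × ℤ →₀ ℚ, ↑g'.support ⊆ (D : Set (ℤ × ℤ)) ∧ (∀ i : D, g' i = g i) ∧
      ∀ r x, app (toRows g') (fun r x => ψ (d (x, r))) r x = κ := by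
  classical
  refine ⟨Finsupp.onFinset D (fun z => if h : z ∈ D then g ⟨z, h⟩ else 0) ?_, ?_, ?_, ?_⟩
  · intro z hz
    by_contra hzD
    simp [hzD] at hz
  · exact Finsupp.support_onFinset_subset
  · intro i
    simp
  · intro r x
    rw [app_toRows, Finsupp.onFinset_sum _ (by simp), ← Finset.sum_coe_sort,
      ← h _ ⟨(x, r), fun z => rfl⟩]
    refine Finset.sum_congr rfl fun z _ => ?_
    simp only [Finset.coe_mem, dif_pos]
    rw [add_comm x]
    rfl

/-- A horizontal translation fixes every configuration with few `D`-patterns that has, in its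
orbit closure, a configuration which first differs from it above a strip containing `D`. -/
theorem exists_horizontal_period {A : Type*} [Finite A] {d e : ℤ × ℤ → A} {D : Finset (ℤ × ℤ)}
    {H : ℤ} (hH : ∀ z ∈ D, ∀ z' ∈ D, z.2 - z'.2 < H)
    (hrow : ∀ x x' x'' y, (x, y) ∈ D → (x'', y) ∈ D → x ≤ x' → x' ≤ x'' → (x', y) ∈ D)
    (hconv : ∀ (B : ℕ) (x₁ y₁ x₂ y₂ y : ℤ), 0 < B → (x₁, y₁) ∈ D → (x₁ + B, y₁) ∈ D →
      (x₂, y₂) ∈ D → (x₂ + B, y₂) ∈ D → y₂ ≤ y → y ≤ y₁ → ∃ x, (x, y) ∈ D ∧ (x + B - 1, y) ∈ D)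
    (hagree : ∀ x r, -H < r → r < 0 → d (x, r) = e (x, r))
    (hdiff : ∃ x, d (x, 0) ≠ e (x, 0))
    (hcl : ∀ (F : Finset (ℤ × ℤ)) (t : ℤ × ℤ), ∃ t', ∀ z ∈ F, e (z + t) = d (z + t'))
    (hP : {f : D → A | ∃ t : ℤ × ℤ, ∀ z : D, f z = d (z + t)}.ncard ≤ D.card) :
    ∃ Q : ℕ, 0 < Q ∧ ∀ x y, d (x + Q, y) = d (x, y) := by
  classical
  by_contra hno
  obtain ⟨ψ, hψ⟩ : ∃ ψ : A → ℚ, Function.Injective ψ :=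
    ⟨fun a => ((Finite.equivFin A a : ℕ) : ℚ), fun a b h => by simpa [Fin.val_inj] using h⟩
  set P := {f : D → A | ∃ t : ℤ × ℤ, ∀ z : D, f z = d (z + t)} with hPdef
  have hPne : P.Nonempty := ⟨fun z => d (z + 0), 0, fun z => rfl⟩
  by_cases hrel : ∃ (g : ℤ × ℤ →₀ ℚ) (κ : ℚ), g ≠ 0 ∧ ↑g.support ⊆ (D : Set (ℤ × ℤ)) ∧
      ∀ r x, app (toRows g) (fun r x => ψ (d (x, r))) r x = κ
  swap
  · have := card_add_finrank_le_ncard_patterns P hPne ψ ∅ (fun g κ hg _ => by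
      by_contra hg0
      obtain ⟨g', h1, h2, h3⟩ := exists_finsupp_relation hg
      refine hrel ⟨g', κ, fun h => hg0 (funext fun i => ?_), h1, h3⟩
      rw [← h2, h]; rfl) ⊥ bot_le (by simp)
    simp at this
    omega
  obtain ⟨g, κ, hg, hgD, hgκ⟩ := hrel
  have hDne : D.Nonempty := by
    obtain ⟨z, hz⟩ := Finsupp.ne_iff.1 hg
    exact ⟨z, hgD (show z ∈ ↑g.support by simpa using hz)⟩
  obtain ⟨n, b, q, hb, hq, hmin, hspread, hper, hwin, hspan⟩ :=
    exists_relation_constants hψ hH hagree hdiff hcl hg hgD hgκ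
  obtain ⟨N, hN⟩ : ∃ N : ℕ, ∀ z ∈ D, ∀ z' ∈ D, z'.1 - z.1 < N := by
    refine ⟨(D.sup fun z => z.1.natAbs) * 2 + 1, fun z hz z' hz' => ?_⟩
    have h1 := Finset.le_sup (f := fun z : ℤ × ℤ => z.1.natAbs) hz
    have h2 := Finset.le_sup (f := fun z : ℤ × ℤ => z.1.natAbs) hz'
    omega
  set rowsD := D.image Prod.snd with hrowsD
  have hrne : rowsD.Nonempty := hDne.image _
  set y₀ := rowsD.min' hrne with hy₀
  set y₁ := rowsD.max' hrne with hy₁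
  have hmem : ∀ x y, (x, y) ∈ D → y₀ ≤ y ∧ y ≤ y₁ := fun x y h => by
    have : y ∈ rowsD := Finset.mem_image.2 ⟨_, h, rfl⟩
    exact ⟨rowsD.min'_le _ this, rowsD.le_max' _ this⟩
  obtain ⟨z₀, hz₀, hz₀y⟩ := Finset.mem_image.1 (rowsD.min'_mem hrne)
  obtain ⟨z₁, hz₁, hz₁y⟩ := Finset.mem_image.1 (rowsD.max'_mem hrne)
  set Y : ℕ → Finset ℤ := fun j => rowsD.filter fun y => ∃ x : ℤ, (x, y) ∈ D ∧
    (x + b + j, y) ∈ D with hY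
  have hYmem : ∀ j y, y ∈ Y j ↔ ∃ x : ℤ, (x, y) ∈ D ∧ (x + b + j, y) ∈ D := by
    intro j y
    simp only [hY, Finset.mem_filter, and_iff_right_iff_imp]
    rintro ⟨x, hx, -⟩
    exact Finset.mem_image.2 ⟨_, hx, rfl⟩
  have hYanti : Antitone Y := by
    intro i j hij y hy
    rw [hYmem] at hy ⊢
    obtain ⟨x, h1, h2⟩ := hy
    exact ⟨x, h1, hrow _ _ _ _ h1 h2 (by omega) (by omega)⟩
  obtain ⟨w, hw⟩ := exists_window_of_antitone hYanti ⟨N, by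
    refine Finset.eq_empty_of_forall_notMem fun y hy => ?_
    obtain ⟨x, h1, h2⟩ := (hYmem _ _).1 hy
    have := hN _ h1 _ h2
    simp only at this
    omega⟩ n
  set G : ℕ → Finset (ℤ × ℤ) := fun j => D.filter fun z => (z.1 + j, z.2) ∈ D with hG
  set Z : ℕ → Finset (ℤ × ℤ) := fun j => D.filter fun z => ¬ (w ≤ z.2 ∧ z.2 < w + n) ∧
    (z.1 + b + j, z.2) ∈ D with hZ
  set Φ : ℕ → ℤ → ℕ := fun j y =>
    Module.finrank ℚ ((diffSpace d e q y₁ y).map (pat A (G j))) with hΦ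
  have hGsub : ∀ j, G (j + 1) ⊆ G j := by
    intro j z hz
    simp only [hG, Finset.mem_filter] at hz ⊢
    exact ⟨hz.1, hrow _ _ _ _ hz.1 hz.2 (by omega) (by push_cast; omega)⟩
  have hGshift : ∀ j, ∀ z ∈ G (j + 1), z + (1, 0) ∈ G j := by
    intro j z hz
    rw [show z + (1, 0) = (z.1 + 1, z.2) by ext <;> simp]
    simp only [hG, Finset.mem_filter] at hz ⊢
    refine ⟨hrow z.1 _ _ _ hz.1 hz.2 (by omega) (by push_cast; omega), ?_⟩
    rw [show z.1 + 1 + (j : ℤ) = z.1 + (j + 1 : ℕ) by push_cast; ring]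
    exact hz.2
  have hvalid : ∀ j y ya yb, ya ∈ Y j → yb ∈ Y j → ya + n ≤ y → y ≤ yb →
      Φ j (y + 1) + Φ (j + 1) y < Φ j y + Φ (j + 1) (y + 1) := by
    intro j y ya yb ha hb' hay hyb
    obtain ⟨xa, ha1, ha2⟩ := (hYmem _ _).1 ha
    obtain ⟨xb, hb1, hb2⟩ := (hYmem _ _).1 hb'
    have h1 := hmem _ _ ha1
    have h2 := hmem _ _ hb1
    refine finrank_diffSpace_lt (y₂ := ya) hagree (hGsub j) (hGshift j) hq hb (by omega)
      (by omega) ?_ hwin ?_ ?_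
    · have := hH z₁ hz₁ z₀ hz₀
      omega
    · intro r hr1 hr2
      obtain ⟨x, hx1, hx2⟩ := hconv (b + j) xb yb xa ya r (by omega) hb1
        (by push_cast; rwa [← add_assoc]) ha1 (by push_cast; rwa [← add_assoc]) hr1 (by omega)
      push_cast at hx2
      refine ⟨x, fun k hk => ?_⟩
      simp only [hG, Finset.mem_filter]
      exact ⟨hrow _ _ _ _ hx1 hx2 (by omega) (by omega),
        hrow _ _ _ _ hx1 hx2 (by omega) (by omega)⟩
    · intro Q hQ hqQ hper
      refine hno ⟨Q, hQ, fun x y' => hspread Q hqQ (ya - y) (fun r hr1 hr2 x => ?_) y' x⟩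
      exact hper r hr1 (by omega) x
  have hgap : ∀ j, Φ (j + 1) y₀ + ((Y j).filter fun y => ¬ (w ≤ y ∧ y < w + n)).card ≤
      Φ j y₀ := by
    intro j
    set V := ((Y j).filter fun y => ¬ (w ≤ y ∧ y < w + n)).image
      fun y => if y < w then y + n else y with hV
    have hcard : V.card = ((Y j).filter fun y => ¬ (w ≤ y ∧ y < w + n)).card := by
      refine Finset.card_image_of_injOn fun y hy y' hy' h => ?_
      simp only [Finset.coe_filter, Set.mem_ofPred_eq] at hy hy'
      split_ifs at h <;> omega
    have hVv : ∀ y ∈ V, ∃ ya yb, ya ∈ Y j ∧ yb ∈ Y j ∧ ya + n ≤ y ∧ y ≤ yb := by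
      intro y hy
      obtain ⟨y', hy', rfl⟩ := Finset.mem_image.1 hy
      rw [Finset.mem_filter] at hy'
      rcases hw j with h | ⟨mn, hmn, mx, hmx, h1, h2⟩
      · exact absurd (h y' hy'.1) hy'.2
      · split_ifs with hlt
        · exact ⟨y', mx, hy'.1, hmx, le_rfl, by omega⟩
        · exact ⟨mn, y', hmn, hy'.1, by omega, le_rfl⟩
    rw [← hcard]
    refine add_card_le_of_forall_step (f := Φ j) (g := Φ (j + 1)) (y₁ := y₁) ?_ V ?_ ?_ ?_ ?_
    · have := hmem z₀.1 z₀.2 hz₀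
      omega
    · intro y hy
      obtain ⟨ya, yb, ha, hb', h1, h2⟩ := hVv y hy
      obtain ⟨xa, ha1, -⟩ := (hYmem _ _).1 ha
      obtain ⟨xb, hb1, -⟩ := (hYmem _ _).1 hb'
      have h3 := hmem _ _ ha1
      have h4 := hmem _ _ hb1
      omega
    · simp only [hΦ]
      rw [diffSpace_eq_bot d e q (lt_add_one y₁)]
      rw [Submodule.map_bot, Submodule.map_bot, finrank_bot, finrank_bot]
    · exact fun y => finrank_diffSpace_le d e (hGsub j) q y₁ y
    · intro y hy
      obtain ⟨ya, yb, ha, hb', h1, h2⟩ := hVv y hy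
      exact hvalid j y ya yb ha hb' h1 h2
  have hZstep : ∀ j, (Z j).card ≤ (Z (j + 1)).card +
      ((Y j).filter fun y => ¬ (w ≤ y ∧ y < w + n)).card := by
    intro j
    set T := (Z j).filter fun z => ((z.1 + b + (j + 1 : ℕ) : ℤ), z.2) ∉ D with hT
    have h1 : Z j ⊆ Z (j + 1) ∪ T := by
      intro z hz
      by_cases h : ((z.1 + b + (j + 1 : ℕ) : ℤ), z.2) ∈ D
      · simp only [hZ, Finset.mem_filter] at hz
        simp only [hZ, Finset.mem_union, Finset.mem_filter]
        exact Or.inl ⟨hz.1, hz.2.1, h⟩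
      · exact Finset.mem_union_right _ (Finset.mem_filter.2 ⟨hz, h⟩)
    have h2 : T.card ≤ ((Y j).filter fun y => ¬ (w ≤ y ∧ y < w + n)).card := by
      refine Finset.card_le_card_of_injOn Prod.snd ?_ ?_
      · intro z hz
        simp only [hT, hZ, Finset.coe_filter, Set.mem_ofPred_eq, Finset.mem_filter] at hz
        simp only [Finset.coe_filter, Set.mem_ofPred_eq, hYmem]
        exact ⟨⟨z.1, hz.1.1, hz.1.2.2⟩, hz.1.2.1⟩
      · intro z hz z' hz' h
        simp only [hT, hZ, Finset.coe_filter, Set.mem_ofPred_eq, Finset.mem_filter] at hz hz'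
        refine Prod.ext ?_ h
        rw [h] at hz
        push_cast at hz hz'
        by_contra hne
        rcases lt_or_gt_of_ne hne with hlt | hlt
        · exact hz.2 (hrow _ _ _ _ hz.1.2.2 hz'.1.2.2 (by omega) (by omega))
        · exact hz'.2 (hrow _ _ _ _ hz'.1.2.2 hz.1.2.2 (by omega) (by omega))
    exact (Finset.card_le_card h1).trans ((Finset.card_union_le _ _).trans (by omega))
  have hZΦ : ∀ k j : ℕ, N ≤ j + k → (Z j).card ≤ Φ j y₀ := by
    intro k
    induction k with
    | zero =>
      intro j hj
      have : Z j = ∅ := by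
        refine Finset.filter_eq_empty_iff.2 fun z hz h => ?_
        have := hN _ hz _ h.2
        simp only at this
        omega
      simp [this]
    | succ k ih =>
      intro j hj
      have h1 := ih (j + 1) (by omega)
      have h2 := hgap j
      have h3 := hZstep j
      omega
  have hmain := hZΦ N 0 (by omega)
  have hG0 : G 0 = D := Finset.filter_true_of_mem fun z hz => by simpa using hz
  simp only [hΦ] at hmain
  rw [hG0] at hmain
  have hcount := card_add_finrank_le_ncard_patterns P hPne ψ ((Z 0).subtype (· ∈ D)) (by
    intro g κ hgP hgZ
    obtain ⟨g', h1, h2, h3⟩ := exists_finsupp_relation hgP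
    have hg' : g' = 0 := by
      refine hmin g' κ h3 w fun z hz => ?_
      by_contra hzw
      obtain ⟨k, k', hk, hk', hkk⟩ := hspan g' κ h1 h3 z hz
      have hkD : (k, z.2) ∈ D := h1 (show _ ∈ ↑g'.support by simpa using hk)
      have hkD' : (k', z.2) ∈ D := h1 (show _ ∈ ↑g'.support by simpa using hk')
      refine hk ((h2 ⟨_, hkD⟩).trans (hgZ _ ?_))
      simp only [hZ, Finset.mem_subtype, Finset.mem_filter]
      exact ⟨hkD, hzw, hrow _ _ _ _ hkD hkD' (by omega) (by push_cast; omega)⟩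
    funext i
    rw [← h2, hg']
    rfl) ((diffSpace d e q y₁ y₀).map (pat A D)) (by
    rw [Submodule.map_le_iff_le_comap]
    refine Submodule.span_le.2 ?_
    rintro _ ⟨t, y, h1, h2, rfl⟩
    have hmem : ∀ v, pat A D (formalDiff d e v) ∈ Finsupp.supported ℚ ℚ P := by
      intro v
      rw [formalDiff, map_sub, pat_single, pat_single]
      refine Submodule.sub_mem _ (Finsupp.single_mem_supported ℚ _ ⟨v, fun z => rfl⟩)
        (Finsupp.single_mem_supported ℚ _ ?_)
      obtain ⟨t', ht'⟩ := hcl D v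
      exact ⟨t', fun z => ht' z z.2⟩
    simp only [Submodule.comap_coe, Set.mem_preimage, map_sub, SetLike.mem_coe]
    exact Submodule.sub_mem _ (hmem _) (hmem _)) (by
    rintro _ ⟨m, hm, rfl⟩
    have : diffSpace d e q y₁ y₀ ≤ LinearMap.ker (Finsupp.linearCombination ℚ
        (fun (f : D → A) (o : Option D) => o.elim (1 : ℚ) fun i => ψ (f i)) ∘ₗ pat A D) := by
      refine Submodule.span_le.2 ?_
      rintro _ ⟨t, y, h1, h2, rfl⟩
      simp only [SetLike.mem_coe, LinearMap.mem_ker, LinearMap.comp_apply, formalDiff, map_sub,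
        pat_single, Finsupp.linearCombination_single, one_smul]
      funext o
      cases o with
      | none => simp
      | some z =>
        have h3 := (hmem z.1.1 z.1.2 z.2)
        have h4 := hH z₁ hz₁ z₀ hz₀
        have h5 := hper (z.1.2 + -y) (by omega) (z.1.1 + t)
        simp only [Pi.sub_apply, Option.elim, Pi.zero_apply]
        rw [add_assoc] at h5
        exact sub_eq_zero.2 h5.symm
    exact this hm)
  have hZcard : ((Z 0).subtype (· ∈ D)).card = (Z 0).card := by
    rw [Finset.card_subtype]
    congr 1
    exact Finset.filter_true_of_mem fun z hz => (Finset.mem_filter.1 hz).1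
  rw [Fintype.card_coe, hZcard] at hcount
  omega

theorem exists_basis_change {u : ℤ × ℤ} (hu : u ≠ 0) :
    ∃ (M : (ℤ × ℤ) ≃+ (ℤ × ℤ)) (g : ℤ), 0 < g ∧ ∀ z, inner2 (M z) u = g * z.2 := by
  obtain ⟨v, w⟩ := u
  have hg : 0 < Int.gcd v w := Int.gcd_pos_iff.2 (by
    by_contra! h
    exact hu (Prod.ext h.1 h.2))
  obtain ⟨a, ha⟩ := Int.gcd_dvd_left v w
  obtain ⟨b, hb⟩ := Int.gcd_dvd_right v w
  have hbez := Int.gcd_eq_gcd_ab v w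
  set g := ((Int.gcd v w : ℕ) : ℤ)
  have hg' : 0 < g := Int.natCast_pos.2 hg
  set s := Int.gcdA v w
  set t := Int.gcdB v w
  have h1 : a * s + b * t = 1 := by
    refine mul_left_cancel₀ hg'.ne' ?_
    linear_combination -hbez - s * ha - t * hb
  refine ⟨{ toFun := fun z => (-b * z.1 + s * z.2, a * z.1 + t * z.2)
            invFun := fun z => (-t * z.1 + s * z.2, a * z.1 + b * z.2)
            left_inv := fun z => ?_
            right_inv := fun z => ?_
            map_add' := fun z z' => ?_ }, g, hg', fun z => ?_⟩
  · ext
    · linear_combination z.1 * h1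
    · linear_combination z.2 * h1
  · ext
    · linear_combination z.1 * h1
    · linear_combination z.2 * h1
  · ext <;> simp <;> ring
  · simp only [AddEquiv.coe_mk, Equiv.coe_fn_mk, inner2]
    linear_combination g * z.2 * h1 + (-b * z.1 + s * z.2) * ha + (a * z.1 + t * z.2) * hb

theorem DiscreteConvex.preimage {D : Set (ℤ × ℤ)} (hD : DiscreteConvex D)
    (M : (ℤ × ℤ) →+ (ℤ × ℤ)) : DiscreteConvex (M ⁻¹' D) := by
  obtain ⟨C, hC, rfl⟩ := hD
  have hM : ∀ z : ℤ × ℤ, M z = z.1 • M (1, 0) + z.2 • M (0, 1) := fun z => by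
    rw [← map_zsmul, ← map_zsmul, ← map_add]
    congr 1
    ext <;> simp
  set p := M (1, 0)
  set q := M (0, 1)
  let L : ℝ × ℝ →ₗ[ℝ] ℝ × ℝ :=
    (LinearMap.fst ℝ ℝ ℝ).smulRight ((p.1 : ℝ), (p.2 : ℝ)) +
      (LinearMap.snd ℝ ℝ ℝ).smulRight ((q.1 : ℝ), (q.2 : ℝ))
  refine ⟨L ⁻¹' C, hC.linear_preimage L, ?_⟩
  ext z
  simp [hM z, L]

theorem Convex.ordConnected_slice {C : Set (ℝ × ℝ)} (hC : Convex ℝ C) (y : ℝ) :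
    Set.OrdConnected {x | (x, y) ∈ C} := by
  refine Convex.ordConnected fun x hx x' hx' a b ha hb hab => ?_
  have := hC hx hx' ha hb hab
  simpa [← add_mul, hab] using this

theorem DiscreteConvex.mem_of_row {D : Set (ℤ × ℤ)} (hD : DiscreteConvex D) {x x' x'' y : ℤ}
    (h : (x, y) ∈ D) (h'' : (x'', y) ∈ D) (h1 : x ≤ x') (h2 : x' ≤ x'') : (x', y) ∈ D := by
  obtain ⟨C, hC, rfl⟩ := hD
  exact (hC.ordConnected_slice y).out h h'' ⟨Int.cast_le.2 h1, Int.cast_le.2 h2⟩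

/-- Between two rows containing pairs of points at distance `B`, every row of a convex set contains
`B` consecutive points. -/
theorem DiscreteConvex.exists_mem_row {D : Set (ℤ × ℤ)} (hD : DiscreteConvex D) {B : ℕ}
    {x₁ y₁ x₂ y₂ y : ℤ} (hB : 0 < B) (h1 : (x₁, y₁) ∈ D) (h1' : (x₁ + B, y₁) ∈ D)
    (h2 : (x₂, y₂) ∈ D) (h2' : (x₂ + B, y₂) ∈ D) (hy2 : y₂ ≤ y) (hy1 : y ≤ y₁) :
    ∃ x, (x, y) ∈ D ∧ (x + B - 1, y) ∈ D := by
  obtain ⟨C, hC, rfl⟩ := hD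
  obtain ⟨a, b, ha, hb, hab, hy⟩ : (y : ℝ) ∈ segment ℝ (y₂ : ℝ) y₁ := by
    rw [segment_eq_Icc (Int.cast_le.2 (hy2.trans hy1))]
    exact ⟨Int.cast_le.2 hy2, Int.cast_le.2 hy1⟩
  simp only [Set.mem_preimage, Int.cast_add, Int.cast_natCast] at h1 h1' h2 h2'
  have h3 := hC h2 h1 ha hb hab
  have h4 := hC h2' h1' ha hb hab
  simp only [Prod.smul_mk, Prod.mk_add_mk, smul_eq_mul] at h3 h4 hy
  rw [hy] at h3 h4
  set p : ℝ := a * x₂ + b * x₁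
  rw [show a * ((x₂ : ℝ) + B) + b * (x₁ + B) = p + B by linear_combination (B : ℝ) * hab] at h4
  have hB' : (1 : ℝ) ≤ B := by exact_mod_cast hB
  have h5 := Int.le_ceil p
  have h6 := Int.ceil_lt_add_one p
  refine ⟨⌈p⌉, (hC.ordConnected_slice y).out h3 h4 ⟨h5, by linarith⟩,
    (hC.ordConnected_slice y).out h3 h4 ⟨?_, ?_⟩⟩ <;> push_cast <;> linarith

theorem exists_translate_eqOn_of_mem_orbitClosure {A : Type*} [TopologicalSpace A]
    [DiscreteTopology A] {d e : ℤ × ℤ → A} (he : e ∈ orbitClosure d) (F : Finset (ℤ × ℤ)) :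
    ∃ t, ∀ z ∈ F, e z = d (z + t) := by
  have hopen : IsOpen (Set.pi (F : Set (ℤ × ℤ)) fun z => ({e z} : Set A)) :=
    isOpen_set_pi F.finite_toSet fun z _ => isOpen_discrete _
  obtain ⟨_, hf, t, rfl⟩ := mem_closure_iff.1 he _ hopen fun z _ => rfl
  refine ⟨-t, fun z hz => ?_⟩
  rw [← sub_eq_add_neg]
  exact (hf z hz).symm

/-- (Cyr–Kra) Suppose `d` admits a `u`-balanced set `D`, and some
`e` in the orbit closure of `d` agrees with `d` on the interior of a stripe `S`
perpendicular to `u` in which `D` fits, but differs from `d` on `S`. Then `d` is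
periodic in a direction perpendicular to `u`. -/
theorem periodic_of_balanced_stripe
    {A : Type*} [Fintype A] [TopologicalSpace A] [DiscreteTopology A]
    (d : ℤ × ℤ → A) (u : ℤ × ℤ) (hu : u ≠ 0)
    (D : Set (ℤ × ℤ)) (hD : IsBalanced d u D)
    (e : ℤ × ℤ → A) (he : e ∈ orbitClosure d)
    (k : ℤ)
    (hfits : ∃ t : ℤ × ℤ, ∀ x ∈ D, x + t ∈ stripe u k)
    (hint : Set.EqOn d e (stripeInterior u k))
    (hdiff : ¬ Set.EqOn d e (stripe u k)) :
    ∃ p : ℤ × ℤ, p ≠ 0 ∧ inner2 p u = 0 ∧ Translate p d = d := by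
  obtain ⟨hDfin, -, hDconv, hP, -⟩ := hD
  obtain ⟨M, g, hg, hM⟩ := exists_basis_change hu
  have hD'fin : (M ⁻¹' D).Finite := hDfin.preimage M.injective.injOn
  have hD'conv : DiscreteConvex (M ⁻¹' D) := hDconv.preimage M.toAddMonoidHom
  set D' : Finset (ℤ × ℤ) := hD'fin.toFinset
  have hmem : ∀ z, z ∈ D' ↔ M z ∈ D := fun z => by simp [D']
  obtain ⟨t, ht⟩ := hfits
  have hrange : ∀ z ∈ D, -k < g * (M.symm z + M.symm t).2 ∧ g * (M.symm z + M.symm t).2 ≤ 0 := by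
    intro z hz
    rw [← map_add, ← hM, M.apply_symm_apply]
    exact ht z hz
  set H := (k + g - 1) / g
  have hH1 : g * H ≤ k + g - 1 := Int.mul_ediv_self_le hg.ne'
  have hH2 : k + g - 1 < g * H + g := Int.lt_mul_ediv_self_add hg
  obtain ⟨Q, hQ, hper⟩ := exists_horizontal_period (d := d ∘ M) (e := e ∘ M) (D := D') (H := H)
    (fun z hz z' hz' => by
      have h1 := (hrange _ ((hmem z).1 hz)).2
      have h2 := (hrange _ ((hmem z').1 hz')).1
      simp only [M.symm_apply_apply, Prod.snd_add] at h1 h2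
      by_contra! h
      nlinarith)
    (fun x x' x'' y h h'' h1 h2 => by
      rw [hmem] at *
      exact hD'conv.mem_of_row h h'' h1 h2)
    (fun B x₁ y₁ x₂ y₂ y hB h1 h1' h2 h2' hy2 hy1 => by
      simp only [hmem] at *
      exact hD'conv.exists_mem_row hB h1 h1' h2 h2' hy2 hy1)
    (fun x r hr hr' => by
      refine hint ⟨?_, ?_⟩ <;> rw [hM] <;> nlinarith)
    (by
      by_contra! h
      refine hdiff fun z hz => ?_
      rcases lt_or_eq_of_le hz.2 with h1 | h1
      · exact hint ⟨hz.1, h1⟩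
      · have h2 := hM (M.symm z)
        rw [M.apply_symm_apply, h1] at h2
        have h3 : (M.symm z).2 = 0 := by
          rcases mul_eq_zero.1 h2.symm with h | h
          · exact absurd h hg.ne'
          · exact h
        have h4 := h (M.symm z).1
        rw [← h3] at h4
        simpa using h4)
    (fun F t => by
      classical
      obtain ⟨t', ht'⟩ := exists_translate_eqOn_of_mem_orbitClosure he (F.image fun z => M (z + t))
      refine ⟨t + M.symm t', fun z hz => ?_⟩
      have := ht' _ (Finset.mem_image_of_mem _ hz)
      simpa [add_assoc] using this)
    (by
      have : Finite D := hDfin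
      have hcard : D.ncard = D'.card := by
        rw [← Set.ncard_coe_finset, hD'fin.coe_toFinset]
        exact (Set.ncard_preimage_of_injective_subset_range M.injective
          (by rw [M.surjective.range_eq]; exact Set.subset_univ _)).symm
      rw [← hcard]
      refine le_trans (Set.ncard_le_ncard_of_injOn
        (fun f (z : D) => f ⟨M.symm z, by simp [hmem]⟩) ?_ ?_ (Set.toFinite _)) hP
      · rintro f ⟨s, hs⟩
        exact ⟨-M s, fun z => by simp [hs, Translate]⟩
      · intro f _ f' _ h
        funext z
        have := congrFun h ⟨M z, (hmem _).1 z.2⟩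
        simpa using this)
  refine ⟨M (Q, 0), ?_, ?_, ?_⟩
  · rw [Ne, map_eq_zero_iff M M.injective, Prod.mk_eq_zero]
    omega
  · rw [hM]
    simp
  · funext n
    obtain ⟨z, rfl⟩ := M.surjective n
    have := hper (z.1 - Q) z.2
    rw [sub_add_cancel] at this
    rw [Translate, ← map_sub]
    exact (this.trans (by simp [Function.comp, Prod.sub_def] )).symm
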